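/- arXiv:1907.07664 — 2 statements merged into one kernel-verified Lean document; each statement's English description precedes it below -/
import Mathlib

section
/- For every real r ≥ 5 and every real x > 1, Σ_{p ≤ x} p^r ≤ (log 3)/3 · (1 + (2/3)^r) · x^{r+1}/log x. -/
/-- The sum of `p ^ 5` over primes `p < n`. -/
def primeFifthSum (n : ℕ) : ℕ := ∑ p ∈ (Finset.range n).filter Nat.Prime, p ^ 5

/-- The sum of `m ^ 5` over `lo ≤ m < lo + 2 ^ d` coprime to `Q`, by binary splitting. -/
def coprimeFifthSum (Q : ℕ) : ℕ → ℕ → ℕ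
  | 0, lo => if Nat.gcd lo Q = 1 then lo ^ 5 else 0
  | d + 1, lo => coprimeFifthSum Q d lo + coprimeFifthSum Q d (lo + 2 ^ d)

/-- Runs through consecutive blocks of lengths `2 ^ d` for `d` in the list, starting at `lo`, and
checks `3 * P * p ≤ 8 * lo ^ 6` at each of them, where `P` bounds the sum of the fifth powers of
the primes up to the end of the block, and `p / 8` bounds `log lo / log 3`. -/
def certifyBlocks (Q : ℕ) : List ℕ → ℕ → ℕ → ℕ → Bool
  | [], _, _, _ => true
  | d :: ds, lo, P, p =>
    let P' := P + coprimeFifthSum Q d lo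
    let p' := if lo ^ 8 ≤ 3 ^ p then p else if lo ^ 8 ≤ 3 ^ (p + 1) then p + 1 else p + 2
    decide (lo ^ 8 ≤ 3 ^ p') && decide (3 * P' * p' ≤ 8 * lo ^ 6) &&
      certifyBlocks Q ds (lo + 2 ^ d) P' p'

lemma primeFifthSum_succ (n : ℕ) :
    primeFifthSum (n + 1) = primeFifthSum n + if n.Prime then n ^ 5 else 0 := by
  simp only [primeFifthSum, Finset.sum_filter, Finset.sum_range_succ]

lemma primeFifthSum_mono : Monotone primeFifthSum :=
  monotone_nat_of_le_succ fun n => by rw [primeFifthSum_succ]; omega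

lemma primeFifthSum_add_two_pow_le {Q : ℕ} (d : ℕ) : ∀ lo : ℕ,
    (∀ q : ℕ, q.Prime → lo ≤ q → Nat.Coprime q Q) →
    primeFifthSum (lo + 2 ^ d) ≤ primeFifthSum lo + coprimeFifthSum Q d lo := by
  induction d with
  | zero =>
    intro lo h
    rw [pow_zero, primeFifthSum_succ, coprimeFifthSum]
    by_cases hlo : lo.Prime
    · simp [hlo, Nat.coprime_iff_gcd_eq_one.1 (h lo hlo le_rfl)]
    · simp [hlo]
  | succ d ih =>
    intro lo h
    have h1 := ih lo h
    have h2 := ih (lo + 2 ^ d) fun q hq hl => h q hq ((Nat.le_add_right _ _).trans hl)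
    rw [pow_succ, mul_two, ← add_assoc, coprimeFifthSum]
    omega

lemma rpow_div_log_mono {s y x : ℝ} (hs : 2 ≤ s) (hy : 2 ≤ y) (hyx : y ≤ x) :
    y ^ s / Real.log y ≤ x ^ s / Real.log x := by
  have hexp : Real.exp s⁻¹ ≤ 2 := by
    rw [← one_div, ← Real.le_log_iff_exp_le (by norm_num)]
    have : 1 / s ≤ 1 / 2 := one_div_le_one_div_of_le (by norm_num) hs
    linarith [Real.log_two_gt_d9]
  have h := Real.log_div_self_rpow_antitoneOn (a := s) (by linarith)
    (hexp.trans hy) (hexp.trans (hy.trans hyx)) hyx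
  have hlx : 0 < Real.log x := Real.log_pos (by linarith)
  have hxs : 0 < x ^ s := Real.rpow_pos_of_pos (by linarith) s
  have h2 := one_div_le_one_div_of_le (div_pos hlx hxs) h
  simpa only [one_div_div] using h2

lemma pow_six_div_log_mono {y x : ℝ} (hy : 2 ≤ y) (hyx : y ≤ x) :
    y ^ 6 / Real.log y ≤ x ^ 6 / Real.log x := by
  have := rpow_div_log_mono (s := (6 : ℕ)) (by norm_num) hy hyx
  simpa only [Real.rpow_natCast] using this

lemma primeFifthSum_le_of_certifyBlocks {Q : ℕ} (ds : List ℕ) : ∀ lo P p : ℕ,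
    certifyBlocks Q ds lo P p = true → 2 ≤ lo → primeFifthSum lo ≤ P →
    (∀ q : ℕ, q.Prime → lo ≤ q → Nat.Coprime q Q) →
    ∀ n : ℕ, lo ≤ n → n < lo + (ds.map (2 ^ ·)).sum →
      (primeFifthSum (n + 1) : ℝ) ≤ Real.log 3 / 3 * ((n : ℝ) ^ 6 / Real.log n) := by
  induction ds with
  | nil => intro lo P p _ _ _ _ n h1 h2; simp at h2; omega
  | cons d ds ih =>
    intro lo P p hc hlo hP hQ n h1 h2
    simp only [certifyBlocks, Bool.and_eq_true, decide_eq_true_eq] at hc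
    set p' := if lo ^ 8 ≤ 3 ^ p then p else if lo ^ 8 ≤ 3 ^ (p + 1) then p + 1 else p + 2
    obtain ⟨⟨hp, hb⟩, hc⟩ := hc
    have hP' : primeFifthSum (lo + 2 ^ d) ≤ P + coprimeFifthSum Q d lo :=
      (primeFifthSum_add_two_pow_le d lo hQ).trans (by omega)
    rw [List.map_cons, List.sum_cons] at h2
    rcases lt_or_ge n (lo + 2 ^ d) with hn | hn
    · have hlo' : (2 : ℝ) ≤ lo := by exact_mod_cast hlo
      have hnat : 3 * primeFifthSum (n + 1) * p' ≤ 8 * lo ^ 6 :=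
        le_trans (by gcongr; exact (primeFifthSum_mono hn).trans hP') hb
      have hreal : 3 * (primeFifthSum (n + 1) : ℝ) * p' ≤ 8 * lo ^ 6 := by exact_mod_cast hnat
      have hlog : 8 * Real.log lo ≤ p' * Real.log 3 := by
        have : Real.log ((lo : ℝ) ^ 8) ≤ Real.log ((3 : ℝ) ^ p') :=
          Real.log_le_log (by positivity) (by exact_mod_cast hp)
        rw [Real.log_pow, Real.log_pow] at this
        exact_mod_cast this
      have hpos : 0 < Real.log lo := Real.log_pos (by linarith)
      refine le_trans ?_ (mul_le_mul_of_nonneg_left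
        (pow_six_div_log_mono hlo' (by exact_mod_cast h1)) (by positivity))
      rw [← mul_div_assoc, le_div_iff₀ hpos]
      have h3 : 0 < Real.log 3 := Real.log_pos (by norm_num)
      have e1 : (primeFifthSum (n + 1) : ℝ) * (8 * Real.log lo)
          ≤ primeFifthSum (n + 1) * (p' * Real.log 3) := by gcongr
      have e2 := mul_le_mul_of_nonneg_right hreal h3.le
      linarith
    · exact ih _ _ _ hc (hlo.trans (Nat.le_add_right _ _)) hP'
        (fun q hq hl => hQ q hq ((Nat.le_add_right _ _).trans hl)) n hn (by omega)

lemma coprime_of_dvd_factorial {Q m q : ℕ} (hQ : Q ∣ m.factorial) (hq : q.Prime) (hm : m < q) :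
    Nat.Coprime q Q :=
  Nat.Coprime.coprime_dvd_right hQ ((Nat.coprime_factorial_iff hq.ne_one).2 (by rwa [hq.minFac_eq]))

lemma primeFifthSum_le_of_lt {n : ℕ} (h5 : 5 ≤ n) (hn : n < 65536) :
    (primeFifthSum (n + 1) : ℝ) ≤ Real.log 3 / 3 * ((n : ℝ) ^ 6 / Real.log n) := by
  have hP : primeFifthSum 5 ≤ 275 ∧ primeFifthSum 32 ≤ 60025150 ∧
      primeFifthSum 64 ≤ 2599294851 := by
    simp only [primeFifthSum, Finset.sum_filter, Finset.sum_range_succ]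
    norm_num
  rcases lt_or_ge n 32 with h | h
  · exact primeFifthSum_le_of_certifyBlocks (Q := 6) (List.replicate 27 0) 5 275 12
      (by decide +kernel) (by norm_num) hP.1
      (fun q hq hl => coprime_of_dvd_factorial (m := 4) (by decide) hq hl) n h5 (by simpa using h)
  rcases lt_or_ge n 64 with h' | h'
  · exact primeFifthSum_le_of_certifyBlocks (Q := 30) (List.replicate 16 1) 32 60025150 26
      (by decide +kernel) (by norm_num) hP.2.1
      (fun q hq hl => coprime_of_dvd_factorial (m := 5) (by decide) hq (by omega)) n h
      (by simpa using h')
  · exact primeFifthSum_le_of_certifyBlocks (Q := 117288381359406970983270)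
      ((List.range 10).flatMap fun k => List.replicate 16 (k + 2)) 64 2599294851 31
      (by decide +kernel) (by norm_num) hP.2.2
      (fun q hq hl => coprime_of_dvd_factorial (m := 61) (by decide +kernel) hq (by omega)) n h'
      (lt_of_lt_of_eq hn (by decide +kernel))

lemma psi_natCast (n : ℕ) :
    Chebyshev.psi n = ∑ d ∈ Finset.Ioc 0 n, ArithmeticFunction.vonMangoldt d := by
  rw [Chebyshev.psi, Nat.floor_natCast]

lemma log_factorial_eq_sum_vonMangoldt {n N : ℕ} (h : n ≤ N) :
    Real.log n.factorial
      = ∑ d ∈ Finset.Ioc 0 N, ArithmeticFunction.vonMangoldt d * ((n / d : ℕ) : ℝ) := by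
  induction n with
  | zero => simp
  | succ n ih =>
    have hdiv : (n + 1).divisors = (Finset.Ioc 0 N).filter (· ∣ n + 1) := by
      ext d
      simp only [Nat.mem_divisors, Finset.mem_filter, Finset.mem_Ioc]
      constructor
      · exact fun ⟨hd, _⟩ =>
          ⟨⟨Nat.pos_of_dvd_of_pos hd n.succ_pos, (Nat.le_of_dvd n.succ_pos hd).trans h⟩, hd⟩
      · exact fun ⟨_, hd⟩ => ⟨hd, n.succ_ne_zero⟩
    rw [Nat.factorial_succ, Nat.cast_mul, Real.log_mul (by positivity) (by positivity),
      ih (by omega), ← ArithmeticFunction.vonMangoldt_sum, hdiv, Finset.sum_filter,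
      ← Finset.sum_add_distrib]
    refine Finset.sum_congr rfl fun d _ => ?_
    rw [Nat.succ_div]
    split_ifs <;> push_cast <;> ring

/-- Chebyshev's combination of logarithms of factorials. -/
noncomputable def chebyshevCombination (n : ℕ) : ℝ :=
  Real.log n.factorial - Real.log (n / 2).factorial - Real.log (n / 3).factorial
    - Real.log (n / 5).factorial + Real.log (n / 30).factorial

lemma chebyshevCombination_eq_sum (n : ℕ) :
    chebyshevCombination n = ∑ d ∈ Finset.Ioc 0 n, ArithmeticFunction.vonMangoldt d *
      (((n / d : ℕ) : ℝ) - ((n / d / 2 : ℕ) : ℝ) - ((n / d / 3 : ℕ) : ℝ) - ((n / d / 5 : ℕ) : ℝ)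
        + ((n / d / 30 : ℕ) : ℝ)) := by
  rw [chebyshevCombination, log_factorial_eq_sum_vonMangoldt le_rfl,
    log_factorial_eq_sum_vonMangoldt (Nat.div_le_self n 2),
    log_factorial_eq_sum_vonMangoldt (Nat.div_le_self n 3),
    log_factorial_eq_sum_vonMangoldt (Nat.div_le_self n 5),
    log_factorial_eq_sum_vonMangoldt (Nat.div_le_self n 30), ← Finset.sum_sub_distrib,
    ← Finset.sum_sub_distrib, ← Finset.sum_sub_distrib, ← Finset.sum_add_distrib]
  refine Finset.sum_congr rfl fun d _ => ?_
  rw [Nat.div_right_comm n 2, Nat.div_right_comm n 3, Nat.div_right_comm n 5,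
    Nat.div_right_comm n 30]
  ring

lemma chebyshevCombination_le_psi (n : ℕ) : chebyshevCombination n ≤ Chebyshev.psi n := by
  rw [chebyshevCombination_eq_sum, psi_natCast]
  refine Finset.sum_le_sum fun d _ => mul_le_of_le_one_right
    ArithmeticFunction.vonMangoldt_nonneg ?_
  generalize n / d = m
  have h : m + m / 30 ≤ 1 + m / 2 + m / 3 + m / 5 := by omega
  have : (m : ℝ) + (m / 30 : ℕ) ≤ 1 + (m / 2 : ℕ) + (m / 3 : ℕ) + (m / 5 : ℕ) := by exact_mod_cast h
  linarith

lemma psi_le_psi_div_six_add (n : ℕ) :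
    Chebyshev.psi n ≤ Chebyshev.psi ((n / 6 : ℕ) : ℝ) + chebyshevCombination n := by
  have hsub : Finset.Ioc 0 (n / 6) = (Finset.Ioc 0 n).filter (· ≤ n / 6) := by
    ext d
    simp only [Finset.mem_Ioc, Finset.mem_filter]
    omega
  rw [chebyshevCombination_eq_sum, psi_natCast, psi_natCast, hsub, Finset.sum_filter,
    ← Finset.sum_add_distrib]
  refine Finset.sum_le_sum fun d hd => ?_
  rw [Finset.mem_Ioc] at hd
  have hpos : 0 ≤ ArithmeticFunction.vonMangoldt d := ArithmeticFunction.vonMangoldt_nonneg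
  split_ifs with h6
  · refine le_add_of_nonneg_right (mul_nonneg hpos ?_)
    generalize n / d = m
    have h : m / 2 + m / 3 + m / 5 ≤ m + m / 30 := by omega
    have : ((m / 2 : ℕ) : ℝ) + (m / 3 : ℕ) + (m / 5 : ℕ) ≤ m + (m / 30 : ℕ) := by exact_mod_cast h
    linarith
  · have h1 : 1 ≤ n / d := (Nat.one_le_div_iff hd.1).2 hd.2
    have h2 : n / d < 6 := (Nat.div_lt_iff_lt_mul hd.1).2 (by omega)
    rw [zero_add]
    refine le_mul_of_one_le_right hpos ?_
    generalize n / d = m at h1 h2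
    have h : 1 + m / 2 + m / 3 + m / 5 ≤ m + m / 30 := by omega
    have : 1 + ((m / 2 : ℕ) : ℝ) + (m / 3 : ℕ) + (m / 5 : ℕ) ≤ m + (m / 30 : ℕ) := by
      exact_mod_cast h
    linarith

lemma log_factorial_le {n : ℕ} (hn : 1 ≤ n) :
    Real.log n.factorial ≤ n * Real.log n - n + Real.log n + 1 := by
  induction n, hn using Nat.le_induction with
  | base => simp
  | succ n hn ih =>
    have hn0 : (0 : ℝ) < n := by exact_mod_cast hn
    rw [Nat.factorial_succ, Nat.cast_mul, Real.log_mul (by positivity) (by positivity)]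
    have h := Real.one_sub_inv_le_log_of_pos (x := ((n + 1 : ℕ) : ℝ) / n) (by positivity)
    rw [Real.log_div (by positivity) (by positivity), inv_div] at h
    have h2 := mul_le_mul_of_nonneg_left h (show (0 : ℝ) ≤ ((n + 1 : ℕ) : ℝ) by positivity)
    rw [mul_sub, mul_div_cancel₀ _ (by positivity)] at h2
    push_cast at h2 ih ⊢
    linarith

lemma log_factorial_le_of_le {n : ℕ} {u : ℝ} (hn : 1 ≤ n) (hu : n ≤ u) :
    Real.log n.factorial ≤ u * Real.log u - u + Real.log u + 1 := by
  have hn1 : (1 : ℝ) ≤ n := by exact_mod_cast hn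
  have hlog : Real.log n ≤ Real.log u := Real.log_le_log (by linarith) hu
  have h := Real.one_sub_inv_le_log_of_pos (x := u / n) (div_pos (by linarith) (by linarith))
  rw [Real.log_div (by linarith) (by linarith), inv_div] at h
  have h2 := mul_le_mul_of_nonneg_left h (show 0 ≤ u by linarith)
  rw [mul_sub, mul_div_cancel₀ _ (by linarith)] at h2
  have h3 := mul_nonneg (sub_nonneg.2 hu) (Real.log_nonneg hn1)
  linarith [log_factorial_le hn]

lemma le_log_factorial_of_lt {n : ℕ} {u : ℝ} (hn : 1 ≤ n) (hu : n ≤ u) (hu' : u < n + 1) :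
    u * Real.log u - u - Real.log u ≤ Real.log n.factorial := by
  have hn1 : (1 : ℝ) ≤ n := by exact_mod_cast hn
  have h := Real.log_le_sub_one_of_pos (x := u / n) (div_pos (by linarith) (by linarith))
  rw [Real.log_div (by linarith) (by linarith)] at h
  have h2 := mul_le_mul_of_nonneg_left h (show (0 : ℝ) ≤ n by linarith)
  rw [mul_sub (n : ℝ) (u / n), mul_div_cancel₀ _ (by linarith)] at h2
  have h3 := mul_nonneg (show 0 ≤ n + 1 - u by linarith) (Real.log_nonneg (hn1.trans hu))
  have h4 := Stirling.le_log_factorial_stirling (n := n) (by omega)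
  have h5 : 0 ≤ Real.log (2 * Real.pi) := Real.log_nonneg (by linarith [Real.two_le_pi])
  linarith [Real.log_nonneg hn1]

lemma log_factorial_div_bounds {n k : ℕ} (hk : 1 ≤ k) (hkn : k ≤ n) :
    (n / k : ℝ) * (Real.log n - Real.log k) - n / k - (Real.log n - Real.log k)
        ≤ Real.log (n / k).factorial ∧
      Real.log (n / k).factorial
        ≤ (n / k : ℝ) * (Real.log n - Real.log k) - n / k + (Real.log n - Real.log k) + 1 := by
  have h1 : 1 ≤ n / k := (Nat.one_le_div_iff hk).2 hkn
  have hk0 : (0 : ℝ) < k := by exact_mod_cast hk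
  have hn0 : (0 : ℝ) < n := by exact_mod_cast hk.trans hkn
  rw [← Real.log_div hn0.ne' hk0.ne']
  refine ⟨le_log_factorial_of_lt h1 Nat.cast_div_le ?_, log_factorial_le_of_le h1 Nat.cast_div_le⟩
  rw [div_lt_iff₀ hk0]
  exact_mod_cast Nat.lt_mul_of_div_lt (Nat.lt_succ_self _) hk

/-- Chebyshev's constant `0.92129…`. -/
noncomputable def chebyshevConst : ℝ :=
  7 / 15 * Real.log 2 + 3 / 10 * Real.log 3 + 1 / 6 * Real.log 5

lemma chebyshevConst_pos : 0 < chebyshevConst := by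
  unfold chebyshevConst
  linarith [Real.log_two_gt_d9, Real.log_three_gt_d9, Real.log_five_gt_d9]

lemma chebyshevConst_lt : chebyshevConst < 0.9213 := by
  unfold chebyshevConst
  linarith [Real.log_two_lt_d9, Real.log_three_lt_d9, Real.log_five_lt_d9]

lemma chebyshevCombination_bounds {n : ℕ} (hn : 30 ≤ n) :
    chebyshevConst * n - 5 * Real.log n ≤ chebyshevCombination n ∧
      chebyshevCombination n ≤ chebyshevConst * n + 5 * Real.log n := by
  have e1 := log_factorial_div_bounds (n := n) (k := 1) le_rfl (by omega)
  have e2 := log_factorial_div_bounds (n := n) (k := 2) (by norm_num) (by omega)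
  have e3 := log_factorial_div_bounds (n := n) (k := 3) (by norm_num) (by omega)
  have e5 := log_factorial_div_bounds (n := n) (k := 5) (by norm_num) (by omega)
  have e30 := log_factorial_div_bounds (n := n) (k := 30) (by norm_num) hn
  have h30 : Real.log 30 = Real.log 2 + Real.log 3 + Real.log 5 := by
    rw [← Real.log_mul (by norm_num) (by norm_num), ← Real.log_mul (by norm_num) (by norm_num)]
    norm_num
  push_cast at e1 e2 e3 e5 e30
  simp only [Nat.div_one, div_one, Real.log_one, sub_zero, h30] at e1 e2 e3 e5 e30
  have b2 := Real.log_two_gt_d9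
  have b3 := Real.log_three_gt_d9
  have b5 := Real.log_five_gt_d9
  unfold chebyshevCombination chebyshevConst
  constructor <;> nlinarith only [e1, e2, e3, e5, e30, b2, b3, b5]

lemma psi_natCast_le_of_lt_thirty {n : ℕ} (hn : n < 30) : Chebyshev.psi n ≤ 165 := by
  have h1 := Chebyshev.psi_le_const_mul_self (x := n) (by positivity)
  have h2 : (n : ℝ) ≤ 29 := by exact_mod_cast Nat.le_of_lt_succ hn
  have h4 : Real.log 4 = 2 * Real.log 2 := by
    rw [show (4 : ℝ) = 2 ^ 2 by norm_num, Real.log_pow]; norm_num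
  have b2 := Real.log_two_lt_d9
  have : (Real.log 4 + 4) * n ≤ 5.5 * 29 := by
    gcongr
    linarith
  linarith

lemma psi_natCast_le (n : ℕ) (hn : 1 ≤ n) :
    Chebyshev.psi n ≤ 6 / 5 * chebyshevConst * n + 3 * Real.log n ^ 2 + 165 := by
  induction n using Nat.strong_induction_on with
  | _ n ih =>
    have ha := chebyshevConst_pos
    rcases lt_or_ge n 30 with h | h
    · have : 0 ≤ 6 / 5 * chebyshevConst * n + 3 * Real.log n ^ 2 := by positivity
      linarith [psi_natCast_le_of_lt_thirty h]
    · have hm : 1 ≤ n / 6 := by omega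
      have h1 := ih (n / 6) (by omega) hm
      have h2 := psi_le_psi_div_six_add n
      have h3 := (chebyshevCombination_bounds h).2
      have hdiv : ((n / 6 : ℕ) : ℝ) ≤ n / 6 := by exact_mod_cast Nat.cast_div_le
      have hm1 : (1 : ℝ) ≤ (n / 6 : ℕ) := by exact_mod_cast hm
      have hn30 : (30 : ℝ) ≤ n := by exact_mod_cast h
      have h6 : Real.log 6 = Real.log 2 + Real.log 3 := by
        rw [← Real.log_mul (by norm_num) (by norm_num)]; norm_num
      have h30 : Real.log 2 + Real.log 3 + Real.log 5 ≤ Real.log n := by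
        rw [← Real.log_mul (by norm_num) (by norm_num), ← Real.log_mul (by norm_num) (by norm_num)]
        exact Real.log_le_log (by norm_num) (by linarith)
      have hlog : Real.log (n / 6 : ℕ) ≤ Real.log n - (Real.log 2 + Real.log 3) := by
        rw [← h6, ← Real.log_div (by linarith) (by norm_num)]
        exact Real.log_le_log (by linarith) hdiv
      have b2 := Real.log_two_gt_d9
      have b3 := Real.log_three_gt_d9
      have b5 := Real.log_five_gt_d9
      have hsq : Real.log (n / 6 : ℕ) ^ 2 ≤ (Real.log n - 1.7) ^ 2 :=
        pow_le_pow_left₀ (Real.log_nonneg hm1) (by linarith) 2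
      have hlin := mul_le_mul_of_nonneg_left hdiv ha.le
      nlinarith only [h1, h2, h3, hsq, hlin, h30, b2, b3, b5]

lemma le_psi_natCast {n N : ℕ} (hn : 1 ≤ n) (hN : n ≤ N) :
    chebyshevConst * n - (5 * Real.log N + 28) ≤ Chebyshev.psi n := by
  have hn1 : (1 : ℝ) ≤ n := by exact_mod_cast hn
  have hlog : Real.log n ≤ Real.log N := Real.log_le_log (by linarith) (by exact_mod_cast hN)
  have hlog0 := Real.log_nonneg hn1
  rcases lt_or_ge n 30 with h | h
  · have h2 : (n : ℝ) ≤ 29 := by exact_mod_cast Nat.le_of_lt_succ h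
    have : chebyshevConst * n ≤ 0.9213 * 29 := by
      gcongr
      exact chebyshevConst_lt.le
    linarith [Chebyshev.psi_nonneg n]
  · linarith [(chebyshevCombination_bounds h).1, chebyshevCombination_le_psi n]

lemma pow_five_div_log_le_succ {n : ℕ} (hn : 1 ≤ n) :
    (n : ℝ) ^ 5 / Real.log n ≤ ((n + 1 : ℕ) : ℝ) ^ 5 / Real.log ((n + 1 : ℕ) : ℝ) := by
  rcases hn.eq_or_lt with rfl | h
  · rw [Nat.cast_one, Real.log_one, div_zero]
    exact div_nonneg (by positivity) (Real.log_natCast_nonneg _)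
  · have := rpow_div_log_mono (s := (5 : ℕ)) (y := n) (x := (n + 1 : ℕ)) (by norm_num)
      (by exact_mod_cast h) (by push_cast; linarith)
    simpa only [Real.rpow_natCast] using this

/-- Summation by parts from a lower bound for `Chebyshev.psi`. -/
lemma primeFifthSum_le_of_le_psi {a D : ℝ} {N : ℕ}
    (h : ∀ n : ℕ, 1 ≤ n → n ≤ N → a * n - D ≤ Chebyshev.psi n) (M : ℕ) (hM : 1 ≤ M) (hMN : M ≤ N) :
    (primeFifthSum (M + 1) : ℝ) ≤ (Chebyshev.psi M - a * M + D) * ((M : ℝ) ^ 5 / Real.log M)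
      + a * ∑ n ∈ Finset.Ioc 1 M, (n : ℝ) ^ 5 / Real.log n := by
  induction M, hM using Nat.le_induction with
  | base => simp [primeFifthSum, Finset.sum_filter, Finset.sum_range_succ, Nat.not_prime_zero,
      Nat.not_prime_one]
  | succ M hM ih =>
    have ih := ih (by omega)
    have hψ := h M hM (by omega)
    have hf := pow_five_div_log_le_succ hM
    have hlog : 0 < Real.log ((M + 1 : ℕ) : ℝ) :=
      Real.log_pos (by exact_mod_cast Nat.lt_succ_of_le hM)
    have hstep : Chebyshev.psi ((M + 1 : ℕ) : ℝ)
        = Chebyshev.psi M + ArithmeticFunction.vonMangoldt (M + 1) := by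
      rw [psi_natCast, psi_natCast, Finset.sum_Ioc_succ_top (Nat.zero_le M)]
    have hprime : ((if (M + 1).Prime then (M + 1) ^ 5 else 0 : ℕ) : ℝ)
        ≤ ArithmeticFunction.vonMangoldt (M + 1)
          * (((M + 1 : ℕ) : ℝ) ^ 5 / Real.log ((M + 1 : ℕ) : ℝ)) := by
      split_ifs with hp
      · rw [ArithmeticFunction.vonMangoldt_apply_prime hp, mul_div_cancel₀ _ hlog.ne']
        exact_mod_cast le_rfl
      · rw [Nat.cast_zero]
        exact mul_nonneg ArithmeticFunction.vonMangoldt_nonneg (by positivity)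
    rw [primeFifthSum_succ, Finset.sum_Ioc_succ_top hM, hstep, Nat.cast_add]
    have hprod := mul_nonneg (show 0 ≤ Chebyshev.psi M - a * M + D by linarith)
      (sub_nonneg.2 hf)
    rw [show a * ((M + 1 : ℕ) : ℝ) = a * M + a by push_cast; ring]
    linarith

lemma pow_five_div_log_succ_le {n : ℕ} (hn : 200 ≤ n) :
    ((n + 1 : ℕ) : ℝ) ^ 5 / Real.log ((n + 1 : ℕ) : ℝ)
      ≤ 0.18 * (((n + 1 : ℕ) : ℝ) ^ 6 / Real.log ((n + 1 : ℕ) : ℝ) - (n : ℝ) ^ 6 / Real.log n) := by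
  have hn' : (200 : ℝ) ≤ n := by exact_mod_cast hn
  have hlog : 4.8 ≤ Real.log n := by
    have h128 : Real.log ((2 : ℝ) ^ 7) ≤ Real.log n :=
      Real.log_le_log (by norm_num) (by linarith)
    rw [Real.log_pow] at h128
    push_cast at h128
    linarith [Real.log_two_gt_d9]
  have hlog1 : 0 < Real.log ((n + 1 : ℕ) : ℝ) :=
    Real.log_pos (by push_cast; linarith)
  have hratio : Real.log ((n + 1 : ℕ) : ℝ) ≤ Real.log n + 1 / n := by
    have h := Real.log_le_sub_one_of_pos (x := ((n + 1 : ℕ) : ℝ) / n) (by positivity)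
    rw [Real.log_div (by positivity) (by linarith)] at h
    have : ((n + 1 : ℕ) : ℝ) / n - 1 = 1 / n := by push_cast; field_simp; ring
    linarith
  have hquot : (n : ℝ) ^ 6 / Real.log n * Real.log ((n + 1 : ℕ) : ℝ)
      ≤ (n : ℝ) ^ 6 + (n : ℝ) ^ 5 / 4.8 := by
    calc (n : ℝ) ^ 6 / Real.log n * Real.log ((n + 1 : ℕ) : ℝ)
        ≤ (n : ℝ) ^ 6 / Real.log n * (Real.log n + 1 / n) := by gcongr
      _ = (n : ℝ) ^ 6 + (n : ℝ) ^ 5 / Real.log n := by field_simp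
      _ ≤ _ := by gcongr
  rw [div_le_iff₀ hlog1, mul_assoc, sub_mul, div_mul_cancel₀ _ hlog1.ne']
  have hpoly : ((n + 1 : ℕ) : ℝ) ^ 5
      ≤ 0.18 * (((n + 1 : ℕ) : ℝ) ^ 6 - ((n : ℝ) ^ 6 + (n : ℝ) ^ 5 / 4.8)) := by
    obtain ⟨t, ht⟩ : ∃ t : ℝ, (n : ℝ) = 200 + t := ⟨n - 200, by ring⟩
    have ht0 : 0 ≤ t := by linarith
    push_cast
    rw [ht, ← sub_nonneg]
    ring_nf
    positivity
  linarith

lemma sum_pow_five_div_log_le {N : ℕ} (hN : 200 ≤ N) :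
    ∑ n ∈ Finset.Ioc 1 N, (n : ℝ) ^ 5 / Real.log n
      ≤ 0.18 * ((N : ℝ) ^ 6 / Real.log N) + 2 * 200 ^ 6 := by
  induction N, hN using Nat.le_induction with
  | base =>
    have hbound : ∀ n ∈ Finset.Ioc 1 (200 : ℕ), (n : ℝ) ^ 5 / Real.log n ≤ 2 * 200 ^ 5 := by
      intro n hn
      rw [Finset.mem_Ioc] at hn
      have h2 : (2 : ℝ) ≤ n := by exact_mod_cast Nat.succ_le_of_lt hn.1
      have hlog : 1 / 2 ≤ Real.log n := by
        linarith [Real.log_two_gt_d9, Real.log_le_log (by norm_num) h2]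
      have h5 : (n : ℝ) ^ 5 ≤ 200 ^ 5 := by
        gcongr
        exact_mod_cast hn.2
      rw [div_le_iff₀ (by linarith)]
      linarith
    have hsum := Finset.sum_le_card_nsmul _ _ _ hbound
    have hnonneg : 0 ≤ ((200 : ℕ) : ℝ) ^ 6 / Real.log ((200 : ℕ) : ℝ) :=
      div_nonneg (by positivity) (Real.log_natCast_nonneg _)
    rw [Nat.card_Ioc, nsmul_eq_mul] at hsum
    norm_num at hsum hnonneg ⊢
    linarith
  | succ N hN ih =>
    rw [Finset.sum_Ioc_succ_top (by omega)]
    linarith [pow_five_div_log_succ_le hN]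

lemma log_error_le {N : ℝ} (hN : 65536 ≤ N) :
    3 * Real.log N ^ 2 + 5 * Real.log N + 193 ≤ 0.015 * N := by
  have hN0 : 0 < N := by linarith
  have hs : (256 : ℝ) ≤ √N := Real.le_sqrt_of_sq_le (by linarith)
  obtain ⟨u, hu⟩ : ∃ u, √N = 256 * u := ⟨√N / 256, by ring⟩
  have hu1 : 1 ≤ u := by linarith
  have hN2 : N = 65536 * u ^ 2 := by
    rw [← Real.sq_sqrt hN0.le, hu]; ring
  have hlog : Real.log N = 16 * Real.log 2 + 2 * Real.log u := by
    rw [hN2, Real.log_mul (by norm_num) (by positivity), Real.log_pow,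
      show (65536 : ℝ) = 2 ^ 16 by norm_num, Real.log_pow]
    push_cast
    ring
  have hL : Real.log N ≤ 9.1 + 2 * u := by
    linarith [Real.log_two_lt_d9, Real.log_le_sub_one_of_pos (show 0 < u by linarith)]
  have hL0 : 0 ≤ Real.log N := Real.log_nonneg (by linarith)
  have hsq : Real.log N ^ 2 ≤ (9.1 + 2 * u) ^ 2 := pow_le_pow_left₀ hL0 hL 2
  rw [hN2] at hsq hL ⊢
  nlinarith

lemma primeFifthSum_le_of_ge {N : ℕ} (hN : 65536 ≤ N) :
    (primeFifthSum (N + 1) : ℝ) ≤ Real.log 3 / 3 * ((N : ℝ) ^ 6 / Real.log N) := by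
  have hN' : (65536 : ℝ) ≤ N := by exact_mod_cast hN
  have hN0 : (0 : ℝ) < N := by linarith
  have hlog : 0 < Real.log N := Real.log_pos (by linarith)
  have hparts := primeFifthSum_le_of_le_psi (fun n hn hnN => le_psi_natCast hn hnN) N (by omega) le_rfl
  have hupper := psi_natCast_le N (by omega)
  have hsum := sum_pow_five_div_log_le (N := N) (by omega)
  have herr := log_error_le hN'
  have ha := chebyshevConst_pos
  have ha' := chebyshevConst_lt
  set a := chebyshevConst
  set g := (N : ℝ) ^ 6 / Real.log N with hg
  have hf : (N : ℝ) ^ 5 / Real.log N * N = g := by rw [hg]; ring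
  have hf0 : 0 ≤ (N : ℝ) ^ 5 / Real.log N := by positivity
  have hg0 : 0 ≤ g := by positivity
  have hconst : 2 * 200 ^ 6 ≤ 0.0001 * g := by
    have h1 : Real.log N ≤ N := (Real.log_le_sub_one_of_pos hN0).trans (by linarith)
    have h2 : (N : ℝ) ^ 5 ≤ g := by
      rw [hg, le_div_iff₀ hlog]
      calc (N : ℝ) ^ 5 * Real.log N ≤ (N : ℝ) ^ 5 * N := by gcongr
        _ = (N : ℝ) ^ 6 := by ring
    have h3 : (65536 : ℝ) ^ 5 ≤ (N : ℝ) ^ 5 := by gcongr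
    linarith
  have hmain : (Chebyshev.psi N - a * N + (5 * Real.log N + 28)) * ((N : ℝ) ^ 5 / Real.log N)
      ≤ (a / 5 + 0.015) * g := by
    calc _ ≤ ((a / 5 + 0.015) * N) * ((N : ℝ) ^ 5 / Real.log N) := by
          gcongr
          linarith
      _ = (a / 5 + 0.015) * g := by rw [← hf]; ring
  have hsum' : a * ∑ n ∈ Finset.Ioc 1 N, (n : ℝ) ^ 5 / Real.log n ≤ a * (0.1801 * g) :=
    mul_le_mul_of_nonneg_left (by linarith) ha.le
  have hcoef : a / 5 + 0.015 + a * 0.1801 ≤ Real.log 3 / 3 := by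
    linarith [Real.log_three_gt_d9]
  have := mul_le_mul_of_nonneg_right hcoef hg0
  linarith

/-- For `x ≥ 5`, the sum of the fifth powers of the primes up to `x` is at most
`(log 3 / 3) * x ^ 6 / log x`. -/
lemma primeFifthSum_floor_le {x : ℝ} (hx : 5 ≤ x) :
    (primeFifthSum (⌊x⌋₊ + 1) : ℝ) ≤ Real.log 3 / 3 * (x ^ 6 / Real.log x) := by
  have h5 : 5 ≤ ⌊x⌋₊ := Nat.le_floor (by exact_mod_cast hx)
  have h2 : (2 : ℝ) ≤ ⌊x⌋₊ := by exact_mod_cast (show 2 ≤ ⌊x⌋₊ by omega)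
  have hfloor : (primeFifthSum (⌊x⌋₊ + 1) : ℝ)
      ≤ Real.log 3 / 3 * ((⌊x⌋₊ : ℝ) ^ 6 / Real.log ⌊x⌋₊) := by
    rcases lt_or_ge ⌊x⌋₊ 65536 with h | h
    · exact primeFifthSum_le_of_lt h5 h
    · exact primeFifthSum_le_of_ge h
  exact hfloor.trans (mul_le_mul_of_nonneg_left
    (pow_six_div_log_mono h2 (Nat.floor_le (by linarith)))
    (div_nonneg (Real.log_nonneg (by norm_num)) (by norm_num)))

lemma sum_primes_rpow_le {r x : ℝ} (hr : 5 ≤ r) (hx : 5 ≤ x) :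
    ∑ p ∈ (Finset.range (⌊x⌋₊ + 1)).filter Nat.Prime, (p : ℝ) ^ r
      ≤ Real.log 3 / 3 * (x ^ (r + 1) / Real.log x) := by
  have hx0 : 0 < x := by linarith
  have hterm : ∀ p ∈ (Finset.range (⌊x⌋₊ + 1)).filter Nat.Prime,
      (p : ℝ) ^ r ≤ x ^ (r - 5) * (p : ℝ) ^ 5 := by
    intro p hp
    rw [Finset.mem_filter, Finset.mem_range] at hp
    have hp0 : (0 : ℝ) < p := by exact_mod_cast hp.2.pos
    have hpx : (p : ℝ) ≤ x := (Nat.le_floor_iff hx0.le).1 (Nat.lt_succ_iff.1 hp.1)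
    calc (p : ℝ) ^ r = (p : ℝ) ^ (r - 5) * (p : ℝ) ^ 5 := by
          rw [← Real.rpow_natCast (p : ℝ) 5, ← Real.rpow_add hp0]
          norm_num
      _ ≤ x ^ (r - 5) * (p : ℝ) ^ 5 := by gcongr
  calc _ ≤ ∑ p ∈ (Finset.range (⌊x⌋₊ + 1)).filter Nat.Prime, x ^ (r - 5) * (p : ℝ) ^ 5 :=
        Finset.sum_le_sum hterm
    _ = x ^ (r - 5) * (primeFifthSum (⌊x⌋₊ + 1) : ℝ) := by
        rw [← Finset.mul_sum, primeFifthSum]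
        push_cast
        rfl
    _ ≤ x ^ (r - 5) * (Real.log 3 / 3 * (x ^ 6 / Real.log x)) := by
        gcongr
        exact primeFifthSum_floor_le hx
    _ = Real.log 3 / 3 * (x ^ (r + 1) / Real.log x) := by
        rw [show r + 1 = r - 5 + (6 : ℕ) by push_cast; ring, Real.rpow_add hx0, Real.rpow_natCast]
        ring

theorem stmt7 (r : ℝ) (hr : 5 ≤ r) (x : ℝ) (hx : 1 < x) :
    ∑ p ∈ (Finset.range (⌊x⌋₊ + 1)).filter Nat.Prime, (p : ℝ) ^ r
      ≤ Real.log 3 / 3 * (1 + (2 / 3 : ℝ) ^ r) * x ^ (r + 1) / Real.log x := by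
  have hlog : 0 < Real.log x := Real.log_pos hx
  have hlog3 : 0 < Real.log 3 := Real.log_pos (by norm_num)
  have hG : 0 < x ^ (r + 1) / Real.log x := by positivity
  rw [mul_div_assoc]
  rcases lt_or_ge x 5 with h5 | h5
  · have hfloor : ⌊x⌋₊ = 1 ∨ ⌊x⌋₊ = 2 ∨ ⌊x⌋₊ = 3 ∨ ⌊x⌋₊ = 4 := by
      have h1 : 1 ≤ ⌊x⌋₊ := Nat.le_floor (by exact_mod_cast hx.le)
      have h2 : ⌊x⌋₊ < 5 := (Nat.floor_lt (by linarith)).2 (by exact_mod_cast h5)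
      omega
    have hle : (⌊x⌋₊ : ℝ) ≤ x := Nat.floor_le (by linarith)
    have hthree (h3 : 3 ≤ x) : (2 : ℝ) ^ r + 3 ^ r
        ≤ Real.log 3 / 3 * (1 + (2 / 3 : ℝ) ^ r) * (x ^ (r + 1) / Real.log x) := by
      have hmono := rpow_div_log_mono (s := r + 1) (y := 3) (by linarith) (by norm_num) h3
      refine le_trans (le_of_eq ?_) (mul_le_mul_of_nonneg_left hmono (by positivity))
      rw [Real.div_rpow (by norm_num) (by norm_num), Real.rpow_add_one (by norm_num)]
      field_simp
      ring
    rcases hfloor with h | h | h | h <;> rw [h] at hle ⊢ <;> push_cast at hle <;>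
      simp only [Finset.sum_filter, Finset.sum_range_succ, Finset.sum_range_zero] <;> norm_num
    · positivity
    · have hmono := rpow_div_log_mono (s := r + 1) (by linarith) le_rfl hle
      have hlog2 : 0 < Real.log 2 := Real.log_pos (by norm_num)
      have hratio : 3 * Real.log 2 ≤ 2 * Real.log 3 := by
        linarith [Real.log_two_lt_d9, Real.log_three_gt_d9]
      have hle2 : (2 : ℝ) ^ r ≤ Real.log 3 / 3 * ((2 : ℝ) ^ (r + 1) / Real.log 2) := by
        rw [Real.rpow_add_one (by norm_num), ← mul_div_assoc, le_div_iff₀ hlog2]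
        have := mul_le_mul_of_nonneg_left hratio (show (0 : ℝ) ≤ 2 ^ r by positivity)
        linarith
      have h1 := mul_le_mul_of_nonneg_left hmono (show 0 ≤ Real.log 3 / 3 by positivity)
      have h2 : 0 < Real.log 3 / 3 * (2 / 3 : ℝ) ^ r * (x ^ (r + 1) / Real.log x) := by positivity
      linarith
    · exact hthree hle
    · exact hthree (by linarith)
  · have h := sum_primes_rpow_le hr h5
    have h2 : 0 < Real.log 3 / 3 * (2 / 3 : ℝ) ^ r * (x ^ (r + 1) / Real.log x) := by positivity
    linarith
end

section
/- If the Riemann hypothesis fails, then the inequality log g(n) < √(li⁻¹(n)) fails for infinitely many n; more precisely, there exists b > 1/4 such that log g(n) − √(li⁻¹(n)) = Ω_±((n log n)^b). Consequently, the statement ‘log g(n) < √(li⁻¹(n)) for all n ≥ 1’ implies the Riemann hypothesis. -/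
/-- The additive function with `ℓ(p^α) = p^α` and `ℓ(1) = 0`. -/
def ell (M : ℕ) : ℕ := ∑ p ∈ M.primeFactors, p ^ (M.factorization p)

open Set Filter Topology MeasureTheory ProbabilityTheory

/-- The truncated Mellin transform `s ↦ ∫_1^∞ φ(t) t^{-s} dt`. -/
noncomputable def tailMellin (φ : ℝ → ℝ) (s : ℂ) : ℂ :=
  ∫ t in Ioi (1 : ℝ), (φ t : ℂ) * (t : ℂ) ^ (-s)

/-- A measurable function on `(1, ∞)` bounded by a multiple of `t ^ m`. -/
def PowerBounded (φ : ℝ → ℝ) (m : ℝ) : Prop :=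
  Measurable φ ∧ ∃ K : ℝ, ∀ t : ℝ, 1 < t → |φ t| ≤ K * t ^ m

lemma PowerBounded.mono {φ : ℝ → ℝ} {m m' : ℝ} (h : PowerBounded φ m) (hm : m ≤ m') :
    PowerBounded φ m' := by
  obtain ⟨h1, K, hK⟩ := h
  refine ⟨h1, |K|, fun t ht ↦ (hK t ht).trans ?_⟩
  have := Real.rpow_le_rpow_of_exponent_le ht.le hm
  have h0 : 0 ≤ t ^ m := Real.rpow_nonneg (by linarith) _
  calc K * t ^ m ≤ |K| * t ^ m := by gcongr; exact le_abs_self K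
    _ ≤ _ := by gcongr

lemma PowerBounded.add {φ χ : ℝ → ℝ} {m : ℝ} (h : PowerBounded φ m) (h' : PowerBounded χ m) :
    PowerBounded (fun t ↦ φ t + χ t) m := by
  obtain ⟨h1, K, hK⟩ := h
  obtain ⟨h1', K', hK'⟩ := h'
  refine ⟨h1.add h1', K + K', fun t ht ↦ (abs_add_le _ _).trans ?_⟩
  linarith [hK t ht, hK' t ht]

lemma PowerBounded.const_mul {φ : ℝ → ℝ} {m : ℝ} (h : PowerBounded φ m) (c : ℝ) :
    PowerBounded (fun t ↦ c * φ t) m := by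
  obtain ⟨h1, K, hK⟩ := h
  refine ⟨h1.const_mul c, |c| * K, fun t ht ↦ ?_⟩
  rw [abs_mul, mul_assoc]
  exact mul_le_mul_of_nonneg_left (hK t ht) (abs_nonneg c)

lemma PowerBounded.indicator {φ : ℝ → ℝ} {m : ℝ} (h : PowerBounded φ m) {S : Set ℝ}
    (hS : MeasurableSet S) : PowerBounded (S.indicator φ) m := by
  obtain ⟨h1, K, hK⟩ := h
  refine ⟨h1.indicator hS, K, fun t ht ↦ ?_⟩
  by_cases hx : t ∈ S
  · simpa [hx] using hK t ht
  · simpa [hx] using (abs_nonneg _).trans (hK t ht)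

lemma PowerBounded.log_mul {φ : ℝ → ℝ} {m m' : ℝ} (h : PowerBounded φ m) (hm : m < m') :
    PowerBounded (fun t ↦ Real.log t * φ t) m' := by
  obtain ⟨h1, K, hK⟩ := h
  refine ⟨Real.measurable_log.mul h1, (m' - m)⁻¹ * K, fun t ht ↦ ?_⟩
  have h0 : 0 < t := by linarith
  have hl := Real.log_le_rpow_div h0.le (sub_pos.2 hm)
  rw [abs_mul, abs_of_nonneg (Real.log_nonneg ht.le)]
  calc Real.log t * |φ t| ≤ (t ^ (m' - m) / (m' - m)) * (K * t ^ m) :=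
        mul_le_mul hl (hK t ht) (abs_nonneg _) ((Real.log_nonneg ht.le).trans hl)
    _ = (m' - m)⁻¹ * K * (t ^ (m' - m) * t ^ m) := by ring
    _ = _ := by rw [← Real.rpow_add h0]; simp

/-- A power-bounded function cut off at a finite point is bounded by every power. -/
lemma PowerBounded.indicator_Iic {φ : ℝ → ℝ} {m : ℝ} (h : PowerBounded φ m) (T m' : ℝ) :
    PowerBounded ((Iic T).indicator φ) m' := by
  rcases le_total m m' with hm | hm
  · exact (h.mono hm).indicator measurableSet_Iic
  obtain ⟨h1, K, hK⟩ := h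
  refine ⟨h1.indicator measurableSet_Iic, |K| * |T| ^ (m - m'), fun t ht ↦ ?_⟩
  have h0 : 0 < t := by linarith
  by_cases hx : t ∈ Iic T
  · rw [indicator_of_mem hx]
    have : t ^ (m - m') ≤ |T| ^ (m - m') :=
      Real.rpow_le_rpow h0.le (le_trans hx (le_abs_self T)) (by linarith)
    calc |φ t| ≤ K * t ^ m := hK t ht
      _ ≤ |K| * t ^ m := by gcongr; exact le_abs_self K
      _ = |K| * t ^ (m - m') * t ^ m' := by
        rw [mul_assoc, ← Real.rpow_add h0]; simp
      _ ≤ _ := by gcongr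
  · rw [indicator_of_notMem hx]
    simp only [abs_zero]
    positivity

lemma tailMellin_eq_mellin (φ : ℝ → ℝ) (s : ℂ) :
    tailMellin φ s = mellin ((Ioi (1 : ℝ)).indicator fun t ↦ (φ t : ℂ)) (1 - s) := by
  rw [mellin, tailMellin]
  have : ∀ t : ℝ, (t : ℂ) ^ (1 - s - 1) • (Ioi (1 : ℝ)).indicator (fun t ↦ (φ t : ℂ)) t =
      (Ioi (1 : ℝ)).indicator (fun t : ℝ ↦ (φ t : ℂ) * (t : ℂ) ^ (-s)) t := by
    intro t
    by_cases ht : t ∈ Ioi (1 : ℝ)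
    · simp only [indicator_of_mem ht, smul_eq_mul]
      rw [mul_comm]; congr 2; ring
    · simp [indicator_of_notMem ht]
  simp_rw [this]
  rw [setIntegral_indicator measurableSet_Ioi]
  congr 2
  ext t; simp only [mem_inter_iff, mem_Ioi]; grind

lemma PowerBounded.integrableOn {φ : ℝ → ℝ} {m : ℝ} (h : PowerBounded φ m) {s : ℂ}
    (hs : m + 1 < s.re) :
    IntegrableOn (fun t : ℝ ↦ (φ t : ℂ) * (t : ℂ) ^ (-s)) (Ioi 1) := by
  obtain ⟨h1, K, hK⟩ := h
  have hi : IntegrableOn (fun t : ℝ ↦ K * t ^ (m - s.re)) (Ioi 1) :=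
    (integrableOn_Ioi_rpow_of_lt (by linarith) one_pos).const_mul K
  refine hi.mono' ?_ ?_
  · have : Measurable fun t : ℝ ↦ (φ t : ℂ) * (t : ℂ) ^ (-s) := by fun_prop
    exact this.aestronglyMeasurable
  · filter_upwards [ae_restrict_mem measurableSet_Ioi] with t ht
    have ht1 : (1 : ℝ) < t := ht
    have h0 : 0 < t := by linarith
    rw [norm_mul, Complex.norm_cpow_eq_rpow_re_of_pos h0, Complex.norm_real, Real.norm_eq_abs,
      sub_eq_add_neg, Real.rpow_add h0, ← mul_assoc]
    simp only [Complex.neg_re]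
    exact mul_le_mul_of_nonneg_right (hK t ht1) (Real.rpow_nonneg h0.le _)

lemma PowerBounded.hasDerivAt_tailMellin {φ : ℝ → ℝ} {m : ℝ} (h : PowerBounded φ m) {s : ℂ}
    (hs : m + 1 < s.re) :
    HasDerivAt (tailMellin φ) (-tailMellin (fun t ↦ Real.log t * φ t) s) s := by
  have hmeas := h.1
  obtain ⟨K, hK⟩ := h.2
  set f : ℝ → ℂ := (Ioi (1 : ℝ)).indicator fun t ↦ (φ t : ℂ) with hf
  have hfm : Measurable f := by
    apply Measurable.indicator _ measurableSet_Ioi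
    fun_prop
  have hb : ∀ t : ℝ, 0 < t → ‖f t‖ ≤ |K| * t ^ m := by
    intro t h0
    by_cases ht : t ∈ Ioi (1 : ℝ)
    · rw [hf, indicator_of_mem ht, Complex.norm_real, Real.norm_eq_abs]
      refine (hK t ht).trans ?_
      gcongr; exact le_abs_self K
    · rw [hf, indicator_of_notMem ht, norm_zero]; positivity
  have hloc : LocallyIntegrableOn f (Ioi 0) := by
    have hc : ContinuousOn (fun t : ℝ ↦ |K| * t ^ m) (Ioi 0) := by
      refine continuousOn_const.mul (ContinuousOn.rpow_const continuousOn_id ?_)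
      intro x hx; exact Or.inl (ne_of_gt hx)
    have := hc.locallyIntegrableOn (μ := volume) measurableSet_Ioi
    rw [locallyIntegrableOn_iff isOpen_Ioi.isLocallyClosed] at this ⊢
    intro k hk hkc
    refine Integrable.mono' (this k hk hkc) hfm.aestronglyMeasurable ?_
    filter_upwards [ae_restrict_mem hkc.measurableSet] with t ht using hb t (hk ht)
  have htop : f =O[atTop] (fun t : ℝ ↦ t ^ (-(-m))) := by
    refine Asymptotics.IsBigO.of_bound |K| ?_
    filter_upwards [eventually_gt_atTop 0] with t ht
    rw [neg_neg, Real.norm_of_nonneg (Real.rpow_nonneg ht.le _)]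
    exact hb t ht
  have hbot : f =O[𝓝[>] 0] (fun t : ℝ ↦ t ^ (-((1 - s).re - 1))) := by
    have : f =ᶠ[𝓝[>] 0] fun _ ↦ 0 := by
      filter_upwards [Ioo_mem_nhdsGT (show (0 : ℝ) < 1 by norm_num)] with t ht
      rw [hf, indicator_of_notMem]
      simp [ht.2.le]
    exact this.trans_isBigO (Asymptotics.isBigO_zero _ _)
  have key := (mellin_hasDerivAt_of_isBigO_rpow (s := 1 - s) hloc htop
    (by simp; linarith) hbot (by simp)).2
  have h2 : HasDerivAt (fun z : ℂ ↦ 1 - z) (-1) s := by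
    simpa using (hasDerivAt_id s).const_sub 1
  have h3 := HasDerivAt.comp s key h2
  have e1 : (mellin f) ∘ (fun z : ℂ ↦ 1 - z) = tailMellin φ := by
    funext z; rw [tailMellin_eq_mellin]; rfl
  rw [e1] at h3
  have e2 : mellin (fun t ↦ Real.log t • f t) (1 - s) * -1 =
      -tailMellin (fun t ↦ Real.log t * φ t) s := by
    rw [tailMellin_eq_mellin, mul_neg_one]
    congr 2
    funext t
    by_cases ht : t ∈ Ioi (1 : ℝ)
    · simp [hf, indicator_of_mem ht]
    · simp [hf, indicator_of_notMem ht]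
  rwa [e2] at h3

lemma PowerBounded.tailMellin_add {φ χ : ℝ → ℝ} {m : ℝ} (h : PowerBounded φ m)
    (h' : PowerBounded χ m) {s : ℂ} (hs : m + 1 < s.re) :
    tailMellin (fun t ↦ φ t + χ t) s = tailMellin φ s + tailMellin χ s := by
  rw [tailMellin, tailMellin, tailMellin, ← integral_add (h.integrableOn hs) (h'.integrableOn hs)]
  congr 1; funext t; push_cast; ring

lemma tailMellin_const_mul (φ : ℝ → ℝ) (c : ℝ) (s : ℂ) :
    tailMellin (fun t ↦ c * φ t) s = c * tailMellin φ s := by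
  rw [tailMellin, tailMellin, ← integral_const_mul]
  congr 1; funext t; push_cast; ring

lemma tailMellin_congr {φ χ : ℝ → ℝ} (h : ∀ t, 1 < t → φ t = χ t) (s : ℂ) :
    tailMellin φ s = tailMellin χ s := by
  rw [tailMellin, tailMellin]
  refine setIntegral_congr_fun measurableSet_Ioi fun t ht ↦ ?_
  simp only [h t ht]

lemma powerBounded_rpow (m : ℝ) : PowerBounded (fun t ↦ t ^ m) m := by
  refine ⟨by fun_prop, 1, fun t ht ↦ ?_⟩
  rw [one_mul, abs_of_nonneg (Real.rpow_nonneg (by linarith) _)]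

lemma tailMellin_rpow {m : ℝ} {s : ℂ} (hs : m + 1 < s.re) :
    tailMellin (fun t ↦ t ^ m) s = (s - m - 1)⁻¹ := by
  have h := integral_Ioi_cpow_of_lt (a := (m : ℂ) - s) (c := 1) (by simp; linarith) one_pos
  rw [tailMellin]
  have : ∫ t in Ioi (1 : ℝ), ((t ^ m : ℝ) : ℂ) * (t : ℂ) ^ (-s) =
      ∫ t in Ioi (1 : ℝ), (t : ℂ) ^ ((m : ℂ) - s) := by
    refine setIntegral_congr_fun measurableSet_Ioi fun t ht ↦ ?_
    have h0 : (0 : ℝ) < t := lt_trans one_pos ht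
    rw [Complex.ofReal_cpow h0.le, sub_eq_add_neg, Complex.cpow_add _ _ (by exact_mod_cast h0.ne')]
  rw [this, h, Complex.ofReal_one, Complex.one_cpow, inv_eq_one_div,
    show (m : ℂ) - s + 1 = -(s - m - 1) by ring, neg_div_neg_eq]

lemma riemannZeta₁_eq_sub_mul {s : ℂ} (hs : s ≠ 1) :
    riemannZeta₁ s = (s - 1) * riemannZeta s := by
  rw [riemannZeta_eq_inv_sub_mul hs, ← mul_assoc, mul_inv_cancel₀ (sub_ne_zero.2 hs), one_mul]

lemma powerBounded_fract : PowerBounded (fun t : ℝ ↦ Int.fract t) 0 := by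
  refine ⟨measurable_fract, 1, fun t _ ↦ ?_⟩
  rw [Real.rpow_zero, mul_one, abs_of_nonneg (Int.fract_nonneg t)]
  exact (Int.fract_lt_one t).le

lemma riemannZeta_eq_mul_tailMellin_floor {s : ℂ} (hs : 1 < s.re) :
    riemannZeta s = s * tailMellin (fun t ↦ (⌊t⌋₊ : ℝ)) (s + 1) := by
  rw [← LSeries_one_eq_riemannZeta hs, LSeries_eq_mul_integral' 1 zero_le_one hs, tailMellin]
  · congr 1
    refine setIntegral_congr_fun measurableSet_Ioi fun t _ ↦ ?_
    simp
  · simpa using Asymptotics.isBigO_refl _ _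

lemma riemannZeta₁_eq_of_one_lt_re {s : ℂ} (hs : 1 < s.re) :
    riemannZeta₁ s = s - s * (s - 1) * tailMellin (fun t ↦ Int.fract t) (s + 1) := by
  have h1 : s - 1 ≠ 0 := fun h ↦ by
    rw [sub_eq_zero.1 h] at hs; simp at hs
  have hf : tailMellin (fun t ↦ (⌊t⌋₊ : ℝ)) (s + 1) =
      (s - 1)⁻¹ - tailMellin (fun t ↦ Int.fract t) (s + 1) := by
    have e := tailMellin_rpow (m := 1) (s := s + 1) (by simp; linarith)
    have e2 := (powerBounded_rpow 1).tailMellin_add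
      ((powerBounded_fract.mono zero_le_one).const_mul (-1)) (s := s + 1) (by simp; linarith)
    rw [tailMellin_const_mul, e] at e2
    rw [tailMellin_congr (χ := fun t ↦ t ^ (1 : ℝ) + -1 * Int.fract t), e2]
    · push_cast; ring
    · intro t ht
      rw [Real.rpow_one, natCast_floor_eq_intCast_floor (by linarith), Int.fract]
      ring
  rw [riemannZeta₁_eq_sub_mul (sub_ne_zero.1 h1), riemannZeta_eq_mul_tailMellin_floor hs, hf]
  field_simp

lemma riemannZeta₁_eq_of_re_pos {s : ℂ} (hs : 0 < s.re) :
    riemannZeta₁ s = s - s * (s - 1) * tailMellin (fun t ↦ Int.fract t) (s + 1) := by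
  have hU : IsOpen {z : ℂ | 0 < z.re} := isOpen_lt continuous_const Complex.continuous_re
  have hd : DifferentiableOn ℂ
      (fun s : ℂ ↦ s - s * (s - 1) * tailMellin (fun t ↦ Int.fract t) (s + 1))
      {z : ℂ | 0 < z.re} := by
    intro z hz
    have h := (powerBounded_fract.hasDerivAt_tailMellin (s := z + 1) (by simpa using hz))
    have h' := (HasDerivAt.comp z h ((hasDerivAt_id z).add_const (1 : ℂ))).differentiableAt
    have h'' : DifferentiableAt ℂ (fun s ↦ tailMellin (fun t ↦ Int.fract t) (s + 1)) z := h'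
    exact (DifferentiableAt.sub (by fun_prop)
      (DifferentiableAt.mul (by fun_prop) h'')).differentiableWithinAt
  have hc : IsPreconnected {z : ℂ | 0 < z.re} := (convex_halfSpace_re_gt 0).isPreconnected
  refine (differentiable_riemannZeta₁.differentiableOn.analyticOnNhd hU).eqOn_of_preconnected_of_eventuallyEq
    (hd.analyticOnNhd hU) hc (z₀ := 2) (by simp) ?_ hs
  filter_upwards [(isOpen_lt continuous_const Complex.continuous_re).mem_nhds
    (show (2 : ℂ) ∈ {z : ℂ | 1 < z.re} by simp)] with z hz
  exact riemannZeta₁_eq_of_one_lt_re hz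

/-- The Riemann zeta function has no zeros on the positive real axis. -/
lemma riemannZeta₁_ofReal_ne_zero {σ : ℝ} (hσ : 0 < σ) : riemannZeta₁ σ ≠ 0 := by
  rcases lt_or_ge 1 σ with h | h
  · have : (σ : ℂ) ≠ 1 := by exact_mod_cast h.ne'
    rw [riemannZeta₁_eq_sub_mul this]
    exact mul_ne_zero (sub_ne_zero.2 this) (riemannZeta_ne_zero_of_one_lt_re (by simpa using h))
  have e : tailMellin (fun t ↦ Int.fract t) (σ + 1) =
      ((∫ t in Ioi (1 : ℝ), Int.fract t * t ^ (-(σ + 1)) : ℝ) : ℂ) := by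
    rw [tailMellin, ← integral_complex_ofReal]
    refine setIntegral_congr_fun measurableSet_Ioi fun t ht ↦ ?_
    have h0 : (0 : ℝ) ≤ t := by linarith [show (1 : ℝ) < t from ht]
    rw [Complex.ofReal_mul, Complex.ofReal_cpow h0]
    push_cast; rfl
  rw [riemannZeta₁_eq_of_re_pos (by simpa using hσ), e]
  set M := ∫ t in Ioi (1 : ℝ), Int.fract t * t ^ (-(σ + 1))
  have hM : 0 ≤ M := setIntegral_nonneg measurableSet_Ioi fun t ht ↦
    mul_nonneg (Int.fract_nonneg t)
      (Real.rpow_nonneg (by linarith [show (1 : ℝ) < t from ht]) _)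
  have : 0 < σ - σ * (σ - 1) * M := by
    nlinarith [mul_nonneg (mul_nonneg hσ.le (sub_nonneg.2 h)) hM]
  exact_mod_cast this.ne'

/-- If the Riemann hypothesis fails, there is a zero to the right of the critical line. -/
lemma exists_zero_of_not_riemannHypothesis (h : ¬ RiemannHypothesis) :
    ∃ ρ : ℂ, 1 / 2 < ρ.re ∧ riemannZeta₁ ρ = 0 := by
  have key : ∃ ρ : ℂ, 1 / 2 < ρ.re ∧ ρ ≠ 1 ∧ riemannZeta ρ = 0 := by
    unfold RiemannHypothesis at h
    push Not at h
    obtain ⟨s, hs, htriv, h1, hre⟩ := h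
    rcases lt_or_gt_of_ne hre with hlt | hgt
    · have hs0 : s ≠ 0 := by
        rintro rfl
        rw [riemannZeta_zero] at hs
        norm_num at hs
      refine ⟨1 - s, by simp; linarith, by simpa using hs0, ?_⟩
      have hfe := riemannZeta_one_sub (s := 1 - s) ?_ (by simpa using hs0)
      · rw [sub_sub_cancel, hs] at hfe
        have hG : Complex.Gamma (1 - s) ≠ 0 :=
          Complex.Gamma_ne_zero_of_re_pos (by simp; linarith)
        have hpi : (2 * (Real.pi : ℂ)) ^ (-(1 - s)) ≠ 0 := by
          rw [Complex.cpow_ne_zero_iff]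
          left; simp [Real.pi_ne_zero]
        have hcos : Complex.cos (Real.pi * (1 - s) / 2) ≠ 0 := by
          intro hc
          obtain ⟨k, hk⟩ := Complex.cos_eq_zero_iff.1 hc
          have hpi0 : (Real.pi : ℂ) ≠ 0 := by exact_mod_cast Real.pi_ne_zero
          have hsk : s = -2 * k := by
            have : (Real.pi : ℂ) * (1 - s) = Real.pi * (2 * k + 1) := by linear_combination 2 * hk
            linear_combination -(mul_left_cancel₀ hpi0 this)
          have hk0 : 0 < k := by
            have hre : s.re = -2 * k := by rw [hsk]; simp
            have hne : k ≠ 0 := fun h0 ↦ hs0 (by rw [hsk, h0]; simp)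
            have : (-1 : ℝ) < k := by linarith
            have : (-1 : ℤ) < k := by exact_mod_cast this
            omega
          obtain ⟨n, hn⟩ := Int.eq_ofNat_of_zero_le (show 0 ≤ k - 1 by omega)
          refine htriv n ?_
          rw [hsk, show k = n + 1 by omega]
          push_cast; ring
        have := hfe.symm
        simpa [hG, hpi, hcos] using this
      · intro n hn
        have := congrArg Complex.re hn
        simp at this
        have hn0 : (0 : ℝ) ≤ n := n.cast_nonneg
        linarith
    · exact ⟨s, hgt, h1, hs⟩
  obtain ⟨ρ, h1, h2, h3⟩ := key
  exact ⟨ρ, h1, by rw [riemannZeta₁_eq_sub_mul h2, h3, mul_zero]⟩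

lemma powerBounded_psi : PowerBounded Chebyshev.psi 1 := by
  refine ⟨Chebyshev.psi_mono.measurable, Real.log 4 + 4, fun t ht ↦ ?_⟩
  rw [Real.rpow_one, abs_of_nonneg (Chebyshev.psi_nonneg t)]
  exact Chebyshev.psi_le_const_mul_self (by linarith)

lemma tailMellin_psi {z : ℂ} (hz : 1 < z.re) :
    z * tailMellin Chebyshev.psi (z + 1) = - deriv riemannZeta z / riemannZeta z := by
  rw [← ArithmeticFunction.LSeries_vonMangoldt_eq_deriv_riemannZeta_div hz,
    LSeries_eq_mul_integral_of_nonneg _ zero_le_one hz _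
      (fun _ ↦ ArithmeticFunction.vonMangoldt_nonneg), tailMellin]
  · congr 1
    refine setIntegral_congr_fun measurableSet_Ioi fun t _ ↦ ?_
    simp only [Chebyshev.psi, Complex.ofReal_sum]
    rfl
  · refine Asymptotics.IsBigO.of_bound (Real.log 4 + 4) (Eventually.of_forall fun n ↦ ?_)
    have h : ∑ k ∈ Finset.Icc 1 n, ArithmeticFunction.vonMangoldt k = Chebyshev.psi n := by
      rw [Chebyshev.psi, Nat.floor_natCast]; rfl
    rw [h, Real.norm_of_nonneg (Chebyshev.psi_nonneg _), Real.rpow_one,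
      Real.norm_of_nonneg n.cast_nonneg]
    exact Chebyshev.psi_le_const_mul_self n.cast_nonneg

lemma tailMellin_psi_eq {z : ℂ} (hz : 1 < z.re) :
    tailMellin Chebyshev.psi (z + 1) =
      (z - 1)⁻¹ - (deriv riemannZeta₁ z / riemannZeta₁ z + 1) / z := by
  have h1 : z ≠ 1 := fun h ↦ by rw [h] at hz; simp at hz
  have h0 : z ≠ 0 := fun h ↦ by rw [h] at hz; simp at hz; linarith
  have h1' := sub_ne_zero.2 h1
  have hζ := riemannZeta_ne_zero_of_one_lt_re hz
  have hz1 : riemannZeta₁ z ≠ 0 := by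
    rw [riemannZeta₁_eq_sub_mul h1]; exact mul_ne_zero h1' hζ
  have := tailMellin_psi hz
  rw [deriv_riemannZeta_eq_neg_inv_sub_sq_mul_add h1, riemannZeta_eq_inv_sub_mul h1] at this
  rw [← mul_right_inj' h0, this]
  field_simp
  ring

/-- Landau's lemma for Laplace transforms: if the moment generating function of a nonpositive
random variable continues analytically across the abscissa `σ₀`, then it converges at some point
to the left of `σ₀`. -/
lemma exists_lt_mem_integrableExpSet {Ω : Type*} [MeasurableSpace Ω] {μ : Measure Ω} {X : Ω → ℝ}
    (hX : AEMeasurable X μ) (h0 : ∀ᵐ ω ∂μ, X ω ≤ 0) {σ₀ r : ℝ} (hr : 0 < r)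
    (hI : Ioi σ₀ ⊆ integrableExpSet X μ) {G : ℂ → ℂ}
    (hG : DifferentiableOn ℂ G (Metric.ball (σ₀ : ℂ) r))
    (hGI : ∀ z ∈ Metric.ball (σ₀ : ℂ) r, σ₀ < z.re → G z = complexMGF X μ z) :
    ∃ σ < σ₀, σ ∈ integrableExpSet X μ := by
  set a : ℝ := σ₀ + r / 4 with ha
  have haI : a ∈ interior (integrableExpSet X μ) :=
    interior_mono hI (by rw [interior_Ioi]; simp [ha, hr])
  have hball : Metric.ball (a : ℂ) (3 * r / 4) ⊆ Metric.ball (σ₀ : ℂ) r := by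
    apply Metric.ball_subset_ball'
    have : dist (a : ℂ) (σ₀ : ℂ) = r / 4 := by
      rw [Complex.dist_of_im_eq (by simp), Complex.ofReal_re, Complex.ofReal_re, Real.dist_eq, ha,
        add_sub_cancel_left, abs_of_pos (by positivity)]
    rw [this]; linarith
  have hw : ((σ₀ - r / 4 : ℝ) : ℂ) ∈ Metric.ball (a : ℂ) (3 * r / 4) := by
    rw [Metric.mem_ball, Complex.dist_of_im_eq (by simp), Complex.ofReal_re, Complex.ofReal_re,
      Real.dist_eq, abs_lt, ha]
    constructor <;> linarith
  have hT := Complex.hasSum_taylorSeries_on_ball (hG.mono hball) hw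
  have hev : G =ᶠ[𝓝 (a : ℂ)] complexMGF X μ := by
    have h1 : ∀ᶠ z in 𝓝 (a : ℂ), z ∈ Metric.ball (a : ℂ) (3 * r / 4) :=
      Metric.ball_mem_nhds _ (by positivity)
    have h2 : ∀ᶠ z in 𝓝 (a : ℂ), σ₀ < z.re :=
      (isOpen_lt continuous_const Complex.continuous_re).mem_nhds (by simp [ha, hr])
    filter_upwards [h1, h2] with z hz hz' using hGI z (hball hz) hz'
  set g : ℕ → Ω → ℝ := fun n ω ↦ (n.factorial : ℝ)⁻¹ * (r / 2 * -X ω) ^ n * Real.exp (a * X ω)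
    with hg
  have hg' : ∀ n, g n = fun ω ↦ ((n.factorial : ℝ)⁻¹ * (-(r / 2)) ^ n) *
      (X ω ^ n * Real.exp (a * X ω)) := by
    intro n; funext ω
    simp only [hg, mul_neg, ← neg_mul, mul_pow]; ring
  have hgi : ∀ n, Integrable (g n) μ := by
    intro n
    rw [hg']
    exact (integrable_pow_mul_exp_of_mem_interior_integrableExpSet haI n).const_mul _
  have hterm : ∀ n : ℕ, (n.factorial : ℂ)⁻¹ • (((σ₀ - r / 4 : ℝ) : ℂ) - a) ^ n •
      iteratedDeriv n G a = ((∫ ω, g n ω ∂μ : ℝ) : ℂ) := by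
    intro n
    rw [hev.iteratedDeriv_eq n, iteratedDeriv_complexMGF (by simpa using haI), hg',
      integral_const_mul, Complex.ofReal_mul, ← integral_complex_ofReal, smul_eq_mul, smul_eq_mul,
      ← mul_assoc]
    congr 1
    · push_cast [ha]; ring
    · refine integral_congr_ae (ae_of_all _ fun ω ↦ ?_)
      simp
  simp_rw [hterm] at hT
  have hsum : Summable fun n ↦ ∫ ω, g n ω ∂μ := Complex.summable_ofReal.1 hT.summable
  have hgn : ∀ᵐ ω ∂μ, ∀ n, 0 ≤ g n ω := by
    filter_upwards [h0] with ω hω n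
    have : 0 ≤ r / 2 * -X ω := mul_nonneg (by positivity) (by linarith)
    positivity
  have hgn' : ∀ n, 0 ≤ ∫ ω, g n ω ∂μ := fun n ↦
    integral_nonneg_of_ae (by filter_upwards [hgn] with ω hω using hω n)
  refine ⟨a - r / 2, by simp only [ha]; linarith, ?_⟩
  rw [integrableExpSet, mem_ofPred_eq]
  refine ⟨(Real.measurable_exp.comp_aemeasurable (hX.const_mul _)).aestronglyMeasurable, ?_⟩
  rw [hasFiniteIntegral_iff_ofReal (ae_of_all _ fun ω ↦ (Real.exp_pos _).le)]
  have hexp : ∀ ω, HasSum (fun n ↦ g n ω) (Real.exp ((a - r / 2) * X ω)) := by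
    intro ω
    have := (NormedSpace.expSeries_div_hasSum_exp (𝔸 := ℝ) (r / 2 * -X ω)).mul_right
      (Real.exp (a * X ω))
    rw [← Real.exp_eq_exp_ℝ, ← Real.exp_add] at this
    rw [show (a - r / 2) * X ω = r / 2 * -X ω + a * X ω by ring]
    simpa only [hg, div_eq_inv_mul] using this
  calc ∫⁻ ω, ENNReal.ofReal (Real.exp ((a - r / 2) * X ω)) ∂μ
      = ∫⁻ ω, ∑' n, ENNReal.ofReal (g n ω) ∂μ := by
        refine lintegral_congr_ae ?_
        filter_upwards [hgn] with ω hω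
        rw [← ENNReal.ofReal_tsum_of_nonneg hω (hexp ω).summable, (hexp ω).tsum_eq]
    _ = ∑' n, ∫⁻ ω, ENNReal.ofReal (g n ω) ∂μ :=
        lintegral_tsum fun n ↦ (hgi n).aemeasurable.ennreal_ofReal
    _ = ∑' n, ENNReal.ofReal (∫ ω, g n ω ∂μ) := by
        congr 1; funext n
        rw [ofReal_integral_eq_lintegral_ofReal (hgi n)]
        filter_upwards [hgn] with ω hω using hω n
    _ = ENNReal.ofReal (∑' n, ∫ ω, g n ω ∂μ) := (ENNReal.ofReal_tsum_of_nonneg hgn' hsum).symm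
    _ < ⊤ := ENNReal.ofReal_lt_top

lemma isOpen_lt_re (σ : ℝ) : IsOpen {s : ℂ | σ < s.re} :=
  isOpen_lt continuous_const Complex.continuous_re

lemma isPreconnected_lt_re (σ : ℝ) : IsPreconnected {s : ℂ | σ < s.re} :=
  (convex_halfSpace_re_gt σ).isPreconnected

/-- If `Z' = K Z` near the centre of a disc with `K` holomorphic, then `Z` has no zeros. -/
lemma ne_zero_of_deriv_eq_mul {Z K : ℂ → ℂ} {c : ℂ} {r : ℝ} (hr : 0 < r)
    (hZ : Differentiable ℂ Z) (hK : DifferentiableOn ℂ K (Metric.ball c r)) (hc : Z c ≠ 0)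
    (h : ∀ᶠ s in 𝓝 c, deriv Z s = K s * Z s) {s : ℂ} (hs : s ∈ Metric.ball c r) : Z s ≠ 0 := by
  have hB : IsOpen (Metric.ball c r) := Metric.isOpen_ball
  have hpc : IsPreconnected (Metric.ball c r) := (convex_ball c r).isPreconnected
  have hcB : c ∈ Metric.ball c r := Metric.mem_ball_self hr
  have heq : EqOn (deriv Z) (fun s ↦ K s * Z s) (Metric.ball c r) :=
    (hZ.deriv.differentiableOn.analyticOnNhd hB).eqOn_of_preconnected_of_eventuallyEq
      ((hK.mul hZ.differentiableOn).analyticOnNhd hB) hpc hcB h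
  obtain ⟨L, hL⟩ := hK.isExactOn_ball
  have hd : ∀ z ∈ Metric.ball c r, HasDerivAt (fun z ↦ Z z * Complex.exp (-L z)) 0 z := by
    intro z hz
    refine ((hZ z).hasDerivAt.mul (hL z hz).neg.cexp).congr_deriv ?_
    rw [heq hz]; ring
  have := hB.is_const_of_deriv_eq_zero hpc
    (fun z hz ↦ (hd z hz).differentiableAt.differentiableWithinAt) (fun z hz ↦ (hd z hz).deriv)
    hs hcB
  intro h0
  simp only [h0, zero_mul] at this
  exact mul_ne_zero hc (Complex.exp_ne_zero _) this.symm

/-- A zero-free region from the holomorphy of `Ψ`, where `Ψ'' = -D' - D` and `D` is expressed by the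
logarithmic derivative of `Z`. -/
lemma ne_zero_of_deriv_deriv_eq {Z ε D Ψ : ℂ → ℂ} {c : ℂ} {r : ℝ} (hr : 0 < r)
    (hZ : Differentiable ℂ Z) (hε : Differentiable ℂ ε)
    (hΨ : DifferentiableOn ℂ Ψ (Metric.ball c r)) (hc : Z c ≠ 0)
    (hD : ∀ᶠ s in 𝓝 c, DifferentiableAt ℂ D s)
    (hDZ : ∀ᶠ s in 𝓝 c, D s * (s - 1) * Z s = -deriv Z s - Z s + (s - 1) * ε s * Z s)
    (hΨD : ∀ᶠ s in 𝓝 c, deriv (deriv Ψ) s = -deriv D s - D s)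
    {s : ℂ} (hs : s ∈ Metric.ball c r) : Z s ≠ 0 := by
  have hB : IsOpen (Metric.ball c r) := Metric.isOpen_ball
  have hΨ2 : DifferentiableOn ℂ (deriv (deriv Ψ)) (Metric.ball c r) :=
    (hΨ.deriv hB).deriv hB
  obtain ⟨W, hW⟩ := (hΨ2.neg.mul Complex.differentiable_exp.differentiableOn).isExactOn_ball
  have hWd : DifferentiableOn ℂ W (Metric.ball c r) :=
    fun z hz ↦ (hW z hz).differentiableAt.differentiableWithinAt
  have hmem : ∀ᶠ z in 𝓝 c, z ∈ Metric.ball c r := Metric.ball_mem_nhds c hr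
  obtain ⟨δ, hδ, hδB⟩ := Metric.eventually_nhds_iff_ball.1
    ((hmem.and hD).and hΨD)
  have hd : ∀ z ∈ Metric.ball c δ, HasDerivAt (fun z ↦ D z * Complex.exp z - W z) 0 z := by
    intro z hz
    obtain ⟨⟨h1, h2⟩, h3⟩ := hδB z hz
    refine ((h2.hasDerivAt.mul (Complex.hasDerivAt_exp z)).sub (hW z h1)).congr_deriv ?_
    simp only [Pi.neg_apply, Pi.mul_apply, h3]; ring
  have hconst : ∀ z ∈ Metric.ball c δ, D z * Complex.exp z - W z = D c * Complex.exp c - W c :=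
    fun z hz ↦ Metric.isOpen_ball.is_const_of_deriv_eq_zero (convex_ball c δ).isPreconnected
      (fun z hz ↦ (hd z hz).differentiableAt.differentiableWithinAt)
      (fun z hz ↦ (hd z hz).deriv) hz (Metric.mem_ball_self hδ)
  refine ne_zero_of_deriv_eq_mul (K := fun s ↦ (s - 1) *
    (ε s - (W s + (D c * Complex.exp c - W c)) * Complex.exp (-s)) - 1) hr hZ ?_ hc ?_ hs
  · have := hε.differentiableOn (s := Metric.ball c r)
    fun_prop
  · filter_upwards [hDZ, Metric.ball_mem_nhds c hδ] with z hz hzδ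
    have h1 : (W z + (D c * Complex.exp c - W c)) * Complex.exp (-z) = D z := by
      rw [← hconst z hzδ, add_sub_cancel, mul_assoc, ← Complex.exp_add, add_neg_cancel,
        Complex.exp_zero, mul_one]
    rw [h1]
    linear_combination hz

lemma ne_zero_on_lt_re_of_deriv_deriv_eq {Z ε D Ψ : ℂ → ℂ} {σ T : ℝ} (hσT : σ < T)
    (hZ : Differentiable ℂ Z) (hε : Differentiable ℂ ε)
    (hΨ : DifferentiableOn ℂ Ψ {s | σ < s.re}) (hZr : ∀ x : ℝ, σ < x → Z x ≠ 0)
    (hD : DifferentiableOn ℂ D {s | T < s.re})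
    (hDZ : ∀ s : ℂ, T < s.re → D s * (s - 1) * Z s = -deriv Z s - Z s + (s - 1) * ε s * Z s)
    (hΨD : ∀ s : ℂ, T < s.re → deriv (deriv Ψ) s = -deriv D s - D s)
    {s : ℂ} (hs : σ < s.re) : Z s ≠ 0 := by
  have hlim : Tendsto (fun N : ℝ ↦ (s.re - σ) ^ 2 - 2 * (N - σ) * (s.re - σ) + s.im ^ 2) atTop
      atBot := by
    have : Tendsto (fun N : ℝ ↦ ((s.re - σ) ^ 2 + s.im ^ 2 + 2 * σ * (s.re - σ)) +
      -(2 * (s.re - σ) * N)) atTop atBot :=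
      tendsto_atBot_add_const_left _ _ (tendsto_neg_atTop_atBot.comp
        (tendsto_id.const_mul_atTop (by linarith)))
    refine this.congr fun N ↦ by ring
  obtain ⟨N, hN1, hN2⟩ := ((hlim.eventually_lt_atBot 0).and (eventually_gt_atTop T)).exists
  have hNσ : 0 < N - σ := by linarith
  have hball : Metric.ball (N : ℂ) (N - σ) ⊆ {s | σ < s.re} := by
    intro z hz
    rw [Metric.mem_ball, dist_eq_norm] at hz
    have := (abs_le.1 (Complex.abs_re_le_norm (z - N))).1
    simp only [Complex.sub_re, Complex.ofReal_re] at this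
    simp only [mem_ofPred_eq]; linarith
  have hsN : s ∈ Metric.ball (N : ℂ) (N - σ) := by
    rw [Metric.mem_ball, dist_eq_norm]
    refine lt_of_pow_lt_pow_left₀ 2 hNσ.le ?_
    rw [← Complex.normSq_eq_norm_sq, Complex.normSq_apply]
    simp only [Complex.sub_re, Complex.ofReal_re, Complex.sub_im, Complex.ofReal_im]
    nlinarith
  have hev : ∀ᶠ z in 𝓝 (N : ℂ), T < z.re := (isOpen_lt_re T).mem_nhds (by simpa using hN2)
  exact ne_zero_of_deriv_deriv_eq hNσ hZ hε (hΨ.mono hball) (hZr N (by linarith))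
    (by filter_upwards [hev] with z hz using hD.differentiableAt ((isOpen_lt_re T).mem_nhds hz))
    (by filter_upwards [hev] with z hz using hDZ z hz)
    (by filter_upwards [hev] with z hz using hΨD z hz) hsN

/-- Holomorphic continuation across a real point at which `Z` does not vanish. -/
lemma exists_continuation_of_deriv_deriv_eq {Z ε D Ψ : ℂ → ℂ} {σ T : ℝ} (hσ : 1 < σ)
    (hσT : σ ≤ T)
    (hZ : Differentiable ℂ Z) (hε : Differentiable ℂ ε)
    (hΨ : DifferentiableOn ℂ Ψ {s | σ < s.re}) (hZσ : Z σ ≠ 0)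
    (hZ0 : ∀ s : ℂ, σ < s.re → Z s ≠ 0)
    (hDZ : ∀ s : ℂ, T < s.re → D s * (s - 1) * Z s = -deriv Z s - Z s + (s - 1) * ε s * Z s)
    (hΨD : ∀ s : ℂ, T < s.re → deriv (deriv Ψ) s = -deriv D s - D s) :
    ∃ r > 0, ∃ G : ℂ → ℂ, DifferentiableOn ℂ G (Metric.ball (σ : ℂ) r) ∧
      ∀ z ∈ Metric.ball (σ : ℂ) r, σ < z.re → G z = Ψ z := by
  have hO := isOpen_lt_re σ
  set Q : ℂ → ℂ := fun s ↦ (-deriv Z s / Z s - 1) / (s - 1) + ε s with hQ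
  have hQd : ∀ s, 1 < s.re → Z s ≠ 0 → DifferentiableAt ℂ Q s := by
    intro s hs hs'
    have h1 : s - 1 ≠ 0 := by
      intro h; rw [sub_eq_zero.1 h] at hs; simp at hs
    exact (((((hZ.deriv s).fun_neg.fun_div (hZ s) hs').sub_const 1).fun_div
      (differentiableAt_id.sub_const 1) h1).fun_add (hε s))
  have hQO : DifferentiableOn ℂ Q {s | σ < s.re} := fun s hs ↦
    (hQd s (hσ.trans hs) (hZ0 s hs)).differentiableWithinAt
  have hDQ : ∀ s : ℂ, T < s.re → D s = Q s := by
    intro s hs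
    have h1 : s - 1 ≠ 0 := by
      intro h; rw [sub_eq_zero.1 h] at hs; simp at hs; linarith
    have h2 : Z s ≠ 0 := hZ0 s (by linarith)
    have := hDZ s hs
    simp only [hQ]
    field_simp
    linear_combination this
  have hΨQ : EqOn (deriv (deriv Ψ)) (fun s ↦ -deriv Q s - Q s) {s | σ < s.re} := by
    refine (((hΨ.deriv hO).deriv hO).analyticOnNhd hO).eqOn_of_preconnected_of_eventuallyEq
      (((hQO.deriv hO).neg.sub hQO).analyticOnNhd hO) (isPreconnected_lt_re σ)
      (z₀ := ((T + 1 : ℝ) : ℂ)) (by simp; linarith) ?_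
    have hev : ∀ᶠ z in 𝓝 ((T + 1 : ℝ) : ℂ), T < z.re :=
      (isOpen_lt_re T).mem_nhds (by simp)
    filter_upwards [hev] with z hz
    have h3 : D =ᶠ[𝓝 z] Q := by
      filter_upwards [(isOpen_lt_re T).mem_nhds hz] with w hw using hDQ w hw
    rw [hΨD z hz, h3.deriv_eq, hDQ z hz]
  have hgood : ∀ᶠ s in 𝓝 (σ : ℂ), 1 < s.re ∧ Z s ≠ 0 :=
    Eventually.and (show ∀ᶠ s in 𝓝 (σ : ℂ), 1 < s.re from
      (isOpen_lt_re 1).mem_nhds (by simpa using hσ))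
      (hZ.continuous.continuousAt.eventually_ne hZσ)
  obtain ⟨r, hr, hrB⟩ := Metric.eventually_nhds_iff_ball.1 hgood
  have hB : IsOpen (Metric.ball (σ : ℂ) r) := Metric.isOpen_ball
  have hQB : DifferentiableOn ℂ Q (Metric.ball (σ : ℂ) r) := fun s hs ↦
    (hQd s (hrB s hs).1 (hrB s hs).2).differentiableWithinAt
  obtain ⟨W, hW⟩ := hQB.isExactOn_ball
  have hWB : DifferentiableOn ℂ W (Metric.ball (σ : ℂ) r) :=
    fun z hz ↦ (hW z hz).differentiableAt.differentiableWithinAt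
  obtain ⟨V, hV⟩ := hWB.isExactOn_ball
  have hVB : DifferentiableOn ℂ V (Metric.ball (σ : ℂ) r) :=
    fun z hz ↦ (hV z hz).differentiableAt.differentiableWithinAt
  have hS : IsOpen (Metric.ball (σ : ℂ) r ∩ {s | σ < s.re}) := hB.inter hO
  have hSc : IsPreconnected (Metric.ball (σ : ℂ) r ∩ {s | σ < s.re}) :=
    ((convex_ball _ _).inter (convex_halfSpace_re_gt σ)).isPreconnected
  have hΨS := hΨ.mono (inter_subset_right (s := Metric.ball (σ : ℂ) r))
  have hat : ∀ {f : ℂ → ℂ} {z : ℂ}, DifferentiableOn ℂ f {s | σ < s.re} → σ < z.re →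
      DifferentiableAt ℂ f z := fun hf hz ↦ hf.differentiableAt (hO.mem_nhds hz)
  obtain ⟨a, ha⟩ := hS.exists_is_const_of_deriv_eq_zero hSc
    (f := fun z ↦ deriv Ψ z + Q z + W z)
    (((hΨ.deriv hO).add hQO).mono inter_subset_right |>.add (hWB.mono inter_subset_left))
    (fun z hz ↦ by
      refine ((((hat (hΨ.deriv hO) hz.2).hasDerivAt.add (hat hQO hz.2).hasDerivAt).add
        (hW z hz.1)).congr_deriv ?_).deriv
      rw [hΨQ hz.2]; simp only [Pi.zero_apply]; ring)
  obtain ⟨b, hb⟩ := hS.exists_is_const_of_deriv_eq_zero hSc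
    (f := fun z ↦ Ψ z + W z + V z - a * z)
    (((hΨS.add (hWB.mono inter_subset_left)).add (hVB.mono inter_subset_left)).sub
      (differentiable_id.const_mul a).differentiableOn)
    (fun z hz ↦ by
      refine (((((hat hΨ hz.2).hasDerivAt.add (hW z hz.1)).add (hV z hz.1)).sub
        ((hasDerivAt_id z).const_mul a)).congr_deriv ?_).deriv
      rw [← ha z hz]; simp)
  refine ⟨r, hr, fun z ↦ a * z + b - W z - V z,
    ((((differentiable_id.const_mul a).add_const b).differentiableOn.sub hWB).sub hVB), ?_⟩
  intro z hz hz'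
  have := hb z ⟨hz, hz'⟩
  linear_combination -this

lemma Ioi_subset_integrableExpSet {Ω : Type*} [MeasurableSpace Ω] {μ : Measure Ω} {X : Ω → ℝ}
    (hX : AEMeasurable X μ) (h0 : ∀ᵐ ω ∂μ, X ω ≤ 0) {σ : ℝ} (h : σ ∈ integrableExpSet X μ) :
    Ici σ ⊆ integrableExpSet X μ := by
  intro τ hτ
  refine Integrable.mono h
    (Real.measurable_exp.comp_aemeasurable (hX.const_mul _)).aestronglyMeasurable ?_
  filter_upwards [h0] with ω hω
  rw [Real.norm_eq_abs, Real.norm_eq_abs, Real.abs_exp, Real.abs_exp, Real.exp_le_exp]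
  exact mul_le_mul_of_nonpos_right hτ hω

lemma differentiableOn_complexMGF_of_Ioi {Ω : Type*} [MeasurableSpace Ω] {μ : Measure Ω}
    {X : Ω → ℝ} {σ : ℝ} (hI : Ioi σ ⊆ integrableExpSet X μ) :
    DifferentiableOn ℂ (complexMGF X μ) {s | σ < s.re} :=
  differentiableOn_complexMGF.mono fun _ hs ↦ interior_mono hI (by rwa [interior_Ioi])

/-- Oscillation principle: one-sided positivity (encoded by the nonpositive random variable `X`)
forces a zero-free half-plane for `Z`. -/
theorem ne_zero_of_nonpos_complexMGF {Ω : Type*} [MeasurableSpace Ω] {μ : Measure Ω}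
    {X : Ω → ℝ} (hX : AEMeasurable X μ) (h0 : ∀ᵐ ω ∂μ, X ω ≤ 0) {Z ε D E : ℂ → ℂ} {τ T : ℝ}
    (hτ : 1 ≤ τ) (hτT : τ < T) {η : ℂ} (hη : η ≠ 0)
    (hZ : Differentiable ℂ Z) (hε : Differentiable ℂ ε)
    (hE : DifferentiableOn ℂ E {s | τ < s.re}) (hZr : ∀ x : ℝ, τ < x → Z x ≠ 0)
    (hI : Ioi T ⊆ integrableExpSet X μ)
    (hD : DifferentiableOn ℂ D {s | T < s.re})
    (hDZ : ∀ s : ℂ, T < s.re → D s * (s - 1) * Z s = -deriv Z s - Z s + (s - 1) * ε s * Z s)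
    (hΨD : ∀ s : ℂ, T < s.re →
      deriv (deriv fun s ↦ E s - η * s * complexMGF X μ s) s = -deriv D s - D s)
    {s : ℂ} (hs : τ < s.re) : Z s ≠ 0 := by
  have hΨ : ∀ σ, τ ≤ σ → Ioi σ ⊆ integrableExpSet X μ →
      DifferentiableOn ℂ (fun s ↦ E s - η * s * complexMGF X μ s) {s | σ < s.re} := by
    intro σ hσ hσI
    have h1 := hE.mono fun s (hs : σ < s.re) ↦ hσ.trans_lt hs
    have h2 := differentiableOn_complexMGF_of_Ioi hσI
    fun_prop
  suffices hmain : Ioi τ ⊆ integrableExpSet X μ from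
    ne_zero_on_lt_re_of_deriv_deriv_eq hτT hZ hε (hΨ τ le_rfl hmain) hZr hD hDZ hΨD hs
  by_contra hcon
  obtain ⟨τ₁, hτ₁, hτ₁I⟩ := not_subset.1 hcon
  have hbdd : ∀ x ∈ integrableExpSet X μ, τ₁ ≤ x := fun x hx ↦ by
    by_contra! h
    exact hτ₁I (Ioi_subset_integrableExpSet hX h0 hx h.le)
  have hne : (integrableExpSet X μ).Nonempty := ⟨T + 1, hI (by simp)⟩
  have hbelow : BddBelow (integrableExpSet X μ) := ⟨τ₁, hbdd⟩
  set σ := sInf (integrableExpSet X μ) with hσ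
  have hσ1 : τ < σ := lt_of_lt_of_le hτ₁ (le_csInf hne hbdd)
  have hσT : σ ≤ T := le_of_forall_gt_imp_ge_of_dense fun x hx ↦ csInf_le hbelow (hI hx)
  have hσI : Ioi σ ⊆ integrableExpSet X μ := by
    intro x hx
    obtain ⟨y, hy, hyx⟩ := exists_lt_of_csInf_lt hne hx
    exact Ioi_subset_integrableExpSet hX h0 hy hyx.le
  have hZ0 : ∀ s : ℂ, σ < s.re → Z s ≠ 0 := fun s hs ↦ by
    have h1 : ∀ {t : ℂ}, T + 1 < t.re → T < t.re := fun h ↦ by linarith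
    exact ne_zero_on_lt_re_of_deriv_deriv_eq (T := T + 1) (by linarith) hZ hε
      (hΨ σ hσ1.le hσI) (fun x hx ↦ hZr x (hσ1.trans hx)) (hD.mono fun s hs ↦ h1 hs)
      (fun s hs ↦ hDZ s (h1 hs)) (fun s hs ↦ hΨD s (h1 hs)) hs
  obtain ⟨r, hr, G, hG, hGΨ⟩ := exists_continuation_of_deriv_deriv_eq (hτ.trans_lt hσ1) hσT hZ hε
    (hΨ σ hσ1.le hσI) (hZr σ hσ1) hZ0 hDZ hΨD
  have hev : ∀ᶠ s in 𝓝 (σ : ℂ), τ < s.re := (isOpen_lt_re τ).mem_nhds (by simpa using hσ1)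
  obtain ⟨δ, hδ, hδB⟩ := Metric.eventually_nhds_iff_ball.1 hev
  have hsub := fun s hs ↦ hδB s (Metric.ball_subset_ball (x := (σ : ℂ)) (min_le_right r δ) hs)
  have hGE : DifferentiableOn ℂ (fun s ↦ (E s - G s) / (η * s))
      (Metric.ball (σ : ℂ) (min r δ)) := by
    have h1 := hG.mono (Metric.ball_subset_ball (x := (σ : ℂ)) (min_le_left r δ))
    have h2 : DifferentiableOn ℂ E (Metric.ball (σ : ℂ) (min r δ)) := hE.mono hsub
    refine (h2.sub h1).fun_div
      (differentiable_id.const_mul η).differentiableOn fun s hs ↦ mul_ne_zero hη ?_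
    rintro h
    have := hsub s hs
    rw [show s = 0 from h, Complex.zero_re] at this
    linarith
  obtain ⟨x, hx, hxI⟩ := exists_lt_mem_integrableExpSet hX h0 (lt_min hr hδ) hσI hGE (by
    intro z hz hz'
    have hz0 : z ≠ 0 := by
      rintro rfl
      rw [Complex.zero_re] at hz'
      linarith
    simp only [hGΨ z (Metric.ball_subset_ball (min_le_left r δ) hz) hz']
    field_simp
    ring)
  exact absurd (csInf_le hbelow hxI) (not_le.2 hx)

lemma integrable_triangle {φ : ℝ → ℝ} (h : PowerBounded φ 1) {s : ℂ} (hs : 2 < s.re) :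
    Integrable (fun p : ℝ × ℝ ↦ (if p.2 < p.1 then (φ p.2 : ℂ) else 0) * (p.1 : ℂ) ^ (-s - 1))
      ((volume.restrict (Ioi (1 : ℝ))).prod (volume.restrict (Ioi (1 : ℝ)))) := by
  obtain ⟨hm, K, hK⟩ := h
  have hp : IntegrableOn (fun x : ℝ ↦ x ^ (-(s.re / 2))) (Ioi (1 : ℝ)) :=
    integrableOn_Ioi_rpow_of_lt (by linarith) one_pos
  refine Integrable.mono' ((hp.mul_prod hp).const_mul |K|) ?_ ?_
  · refine Measurable.aestronglyMeasurable (Measurable.mul (Measurable.ite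
      (measurableSet_lt measurable_snd measurable_fst)
      (Complex.measurable_ofReal.comp (hm.comp measurable_snd)) measurable_const) ?_)
    exact (Complex.measurable_ofReal.comp measurable_fst).pow_const _
  · rw [Measure.prod_restrict]
    refine (ae_restrict_iff' (measurableSet_Ioi.prod measurableSet_Ioi)).2 (ae_of_all _ ?_)
    rintro ⟨x, t⟩ ⟨hx, ht⟩
    have hx : 1 < x := hx
    have ht : 1 < t := ht
    have h0 : 0 ≤ |K| * (x ^ (-(s.re / 2)) * t ^ (-(s.re / 2))) := by positivity
    dsimp only
    split_ifs with htx
    · rw [norm_mul, Complex.norm_real, Complex.norm_cpow_eq_rpow_re_of_pos (by linarith)]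
      have h1 : |φ t| ≤ |K| * t := by
        refine (hK t ht).trans ?_
        rw [Real.rpow_one]
        gcongr
        exact le_abs_self K
      have h2 : t * x ^ (-s - 1).re ≤ x ^ (-(s.re / 2)) * t ^ (-(s.re / 2)) := by
        have e1 : t = t ^ (-(s.re / 2)) * t ^ (1 + s.re / 2) := by
          rw [← Real.rpow_add (by linarith)]; simp
        have e2 : x ^ (-s - 1).re = x ^ (-(s.re / 2)) * x ^ (-(1 + s.re / 2)) := by
          rw [← Real.rpow_add (by linarith)]; congr 1; simp; ring
        have e3 : t ^ (1 + s.re / 2) * x ^ (-(1 + s.re / 2)) ≤ 1 := by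
          rw [Real.rpow_neg (by linarith), ← div_eq_mul_inv]
          exact div_le_one_of_le₀ (Real.rpow_le_rpow (by linarith) htx.le (by linarith))
            (by positivity)
        calc t * x ^ (-s - 1).re = (t ^ (-(s.re / 2)) * t ^ (1 + s.re / 2)) *
              (x ^ (-(s.re / 2)) * x ^ (-(1 + s.re / 2))) := by rw [← e1, ← e2]
          _ = (x ^ (-(s.re / 2)) * t ^ (-(s.re / 2))) *
              (t ^ (1 + s.re / 2) * x ^ (-(1 + s.re / 2))) := by ring
          _ ≤ (x ^ (-(s.re / 2)) * t ^ (-(s.re / 2))) * 1 := by gcongr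
          _ = _ := mul_one _
      calc ‖φ t‖ * x ^ (-s - 1).re ≤ |K| * t * x ^ (-s - 1).re := by
            gcongr; exact h1
        _ = |K| * (t * x ^ (-s - 1).re) := by ring
        _ ≤ _ := by gcongr
    · simpa using h0

/-- The Mellin transform of a primitive. -/
lemma mul_tailMellin_primitive {φ : ℝ → ℝ} (h : PowerBounded φ 1) {s : ℂ} (hs : 2 < s.re) :
    s * tailMellin (fun x ↦ ∫ t in (1)..x, φ t) (s + 1) = tailMellin φ s := by
  have hs0 : s ≠ 0 := by rintro rfl; simp at hs; linarith
  have h1 : tailMellin (fun x ↦ ∫ t in (1)..x, φ t) (s + 1) = ∫ x in Ioi (1 : ℝ),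
      ∫ t in Ioi (1 : ℝ), (if t < x then (φ t : ℂ) else 0) * (x : ℂ) ^ (-s - 1) := by
    refine setIntegral_congr_fun measurableSet_Ioi fun x hx ↦ ?_
    have hx : 1 < x := hx
    simp only
    rw [integral_mul_const, intervalIntegral.integral_of_le hx.le, integral_Ioc_eq_integral_Ioo,
      ← integral_complex_ofReal]
    congr 1
    · have : (fun t ↦ if t < x then (φ t : ℂ) else 0) = (Iio x).indicator fun t ↦ (φ t : ℂ) := by
        funext t; simp [indicator_apply]
      rw [this, setIntegral_indicator measurableSet_Iio]
      rfl
    · congr 1; ring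
  have h2 : tailMellin φ s = s * ∫ t in Ioi (1 : ℝ), ∫ x in Ioi (1 : ℝ),
      (if t < x then (φ t : ℂ) else 0) * (x : ℂ) ^ (-s - 1) := by
    rw [← integral_const_mul]
    refine setIntegral_congr_fun measurableSet_Ioi fun t ht ↦ ?_
    have ht : 1 < t := ht
    have : (fun x : ℝ ↦ (if t < x then (φ t : ℂ) else 0) * (x : ℂ) ^ (-s - 1)) =
        (Ioi t).indicator fun x ↦ (φ t : ℂ) * (x : ℂ) ^ (-s - 1) := by
      funext x; simp [indicator_apply]
    rw [this, setIntegral_indicator measurableSet_Ioi, Ioi_inter_Ioi, max_eq_right ht.le,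
      integral_const_mul, integral_Ioi_cpow_of_lt (by simp; linarith) (by linarith)]
    have : -s - 1 + 1 = -s := by ring
    rw [this]
    field_simp
  rw [h1, h2, integral_integral_swap (integrable_triangle h hs)]

lemma PowerBounded.intervalIntegrable {φ : ℝ → ℝ} {m : ℝ} (hm : 0 ≤ m) (h : PowerBounded φ m)
    (h1 : ∀ t ≤ 1, φ t = 0) (a b : ℝ) : IntervalIntegrable φ volume a b := by
  obtain ⟨hφ, K, hK⟩ := h
  refine IntervalIntegrable.mono_fun' (g := fun t ↦ |K| * |t| ^ m) ?_
    hφ.aestronglyMeasurable.restrict (ae_of_all _ fun t ↦ ?_)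
  · exact (continuous_const.mul (continuous_abs.rpow_const fun _ ↦ Or.inr hm)).intervalIntegrable _ _
  · rcases le_or_gt t 1 with ht | ht
    · simp only [h1 t ht, norm_zero]; positivity
    · simp only [Real.norm_eq_abs]
      rw [abs_of_pos (by linarith : 0 < t)]
      refine (hK t ht).trans ?_
      have : 0 ≤ t ^ m := Real.rpow_nonneg (by linarith) _
      gcongr
      exact le_abs_self K

lemma PowerBounded.primitive {φ : ℝ → ℝ} (h : PowerBounded φ 1)
    (h1 : ∀ t ≤ 1, φ t = 0) : PowerBounded (fun x ↦ ∫ t in (1)..x, φ t) 2 := by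
  refine ⟨(intervalIntegral.continuous_primitive
    (fun a b ↦ h.intervalIntegrable zero_le_one h1 a b) 1).measurable, ?_⟩
  obtain ⟨hφ, K, hK⟩ := h
  refine ⟨|K|, fun x hx ↦ ?_⟩
  have := intervalIntegral.norm_integral_le_of_norm_le_const (f := φ) (a := 1) (b := x)
    (C := |K| * x) fun t ht ↦ ?_
  · refine this.trans ?_
    rw [abs_of_pos (by linarith : 0 < x - 1), Real.rpow_two]
    have : 0 ≤ |K| * x := by positivity
    nlinarith
  · rw [uIoc_of_le hx.le] at ht
    refine (hK t ht.1).trans ?_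
    rw [Real.rpow_one]
    have h0 : 0 ≤ t := by linarith [ht.1]
    calc K * t ≤ |K| * t := by gcongr; exact le_abs_self K
      _ ≤ |K| * x := by gcongr; exact ht.2

/-- The error term `ψ(t) - t`, cut off below `2`. -/
noncomputable def psiError : ℝ → ℝ := (Ici 2).indicator fun t ↦ Chebyshev.psi t - t

/-- The second derivative of `li(y²)`. -/
noncomputable def liSqDeriv₂ (t : ℝ) : ℝ := (Real.log t - 1) / Real.log t ^ 2

/-- The smoothed error term `∫_1^x (d²/dt² li(t²)) (ψ(t) - t) dt`, cut off below `2`. -/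
noncomputable def weightedError (x : ℝ) : ℝ := ∫ t in (1)..x, liSqDeriv₂ t * psiError t

lemma powerBounded_id : PowerBounded (fun t ↦ t) 1 := by
  simpa using powerBounded_rpow 1

lemma powerBounded_psiError : PowerBounded psiError 1 := by
  refine PowerBounded.indicator ?_ measurableSet_Ici
  simpa [sub_eq_add_neg] using powerBounded_psi.add (powerBounded_id.const_mul (-1))

lemma abs_liSqDeriv₂_le {t : ℝ} (ht : 2 ≤ t) : |liSqDeriv₂ t| ≤ 4 := by
  have h1 : 0.6931471803 < Real.log t :=
    Real.log_two_gt_d9.trans_le (Real.log_le_log two_pos ht)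
  have h2 : 0 < Real.log t ^ 2 := by positivity
  rw [liSqDeriv₂, abs_div, abs_of_pos h2, div_le_iff₀ h2, abs_le]
  constructor <;> nlinarith

lemma powerBounded_weight_mul_psiError : PowerBounded (fun t ↦ liSqDeriv₂ t * psiError t) 1 := by
  obtain ⟨hm, K, hK⟩ := powerBounded_psiError
  refine ⟨?_, 4 * K, fun t ht ↦ ?_⟩
  · exact (((Real.measurable_log.sub_const 1).div (Real.measurable_log.pow_const 2))).mul hm
  · rcases lt_or_ge t 2 with h2 | h2
    · have h0 : psiError t = 0 := indicator_of_notMem (by simpa using h2) _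
      have := hK t ht
      rw [h0, abs_zero] at this
      simp only [h0, mul_zero, abs_zero, mul_assoc]
      linarith
    · rw [abs_mul, mul_assoc]
      exact mul_le_mul (abs_liSqDeriv₂_le h2) (hK t ht) (abs_nonneg _) (by norm_num)

lemma weight_mul_psiError_eq_zero {t : ℝ} (ht : t ≤ 1) : liSqDeriv₂ t * psiError t = 0 := by
  have h0 : psiError t = 0 := indicator_of_notMem (by simp; linarith) _
  rw [h0, mul_zero]

lemma powerBounded_weightedError : PowerBounded weightedError 2 :=
  powerBounded_weight_mul_psiError.primitive fun _ ht ↦ weight_mul_psiError_eq_zero ht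

lemma differentiable_tailMellin {φ : ℝ → ℝ} (h : ∀ m, PowerBounded φ m) :
    Differentiable ℂ (tailMellin φ) := fun s ↦
  ((h (s.re - 2)).hasDerivAt_tailMellin (by linarith)).differentiableAt

lemma deriv_deriv_tailMellin {φ : ℝ → ℝ} {m : ℝ} (h : PowerBounded φ m) {s : ℂ}
    (hs : m + 1 < s.re) : deriv (deriv (tailMellin φ)) s =
      tailMellin (fun t ↦ Real.log t * (Real.log t * φ t)) s := by
  have h1 : deriv (tailMellin φ) =ᶠ[𝓝 s] fun z ↦ -tailMellin (fun t ↦ Real.log t * φ t) z := by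
    filter_upwards [(isOpen_lt_re (m + 1)).mem_nhds hs] with z hz
      using (h.hasDerivAt_tailMellin hz).deriv
  obtain ⟨m', hm', hs'⟩ := exists_between hs
  rw [h1.deriv_eq, ((h.log_mul (by linarith : m < m' - 1)).hasDerivAt_tailMellin
    (by linarith)).fun_neg.deriv, neg_neg]

lemma tailMellin_log_log_weight {s : ℂ} (hs : 2 < s.re) :
    tailMellin (fun t ↦ Real.log t * (Real.log t * (liSqDeriv₂ t * psiError t))) s =
      -deriv (tailMellin psiError) s - tailMellin psiError s := by
  obtain ⟨m', hm', hs'⟩ := exists_between hs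
  rw [(powerBounded_psiError.hasDerivAt_tailMellin (by linarith)).deriv, neg_neg, sub_eq_add_neg]
  have h1 : PowerBounded psiError (m' - 1) := powerBounded_psiError.mono (by linarith)
  have h2 := powerBounded_psiError.log_mul (by linarith : (1 : ℝ) < m' - 1)
  have h3 := tailMellin_const_mul psiError (-1) s
  push_cast at h3
  rw [neg_one_mul] at h3
  rw [← h3, ← h2.tailMellin_add (h1.const_mul (-1)) (by linarith)]
  refine tailMellin_congr (fun t ht ↦ ?_) s
  have : Real.log t ≠ 0 := (Real.log_pos ht).ne'
  rw [liSqDeriv₂]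
  field_simp
  ring

lemma powerBounded_low (m : ℝ) : PowerBounded ((Iio 2).indicator fun t : ℝ ↦ t) m := by
  have := (powerBounded_id.indicator_Iic 2 m).indicator (measurableSet_Iio (a := 2))
  rwa [indicator_indicator, inter_eq_left.2 Iio_subset_Iic_self] at this

lemma tailMellin_psiError {s : ℂ} (hs : 2 < s.re) : tailMellin psiError s =
    -(deriv riemannZeta₁ (s - 1) / riemannZeta₁ (s - 1) + 1) / (s - 1) +
      tailMellin ((Iio 2).indicator fun t : ℝ ↦ t) s := by
  have h1 := tailMellin_psi_eq (z := s - 1) (by simp; linarith)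
  have h2 := tailMellin_rpow (m := 1) (s := s) (by linarith)
  have h3 := tailMellin_const_mul (fun t : ℝ ↦ t ^ (1 : ℝ)) (-1) s
  have h4 := powerBounded_psi.tailMellin_add ((powerBounded_rpow 1).const_mul (-1))
    (s := s) (by linarith)
  have h5 := (powerBounded_psi.add ((powerBounded_rpow 1).const_mul (-1))).tailMellin_add
    (powerBounded_low 1) (s := s) (by linarith)
  have h6 : tailMellin psiError s = tailMellin (fun t ↦ (Chebyshev.psi t + -1 * t ^ (1 : ℝ)) +
      (Iio 2).indicator (fun t : ℝ ↦ t) t) s := by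
    refine tailMellin_congr (fun t ht ↦ ?_) s
    rcases lt_or_ge t 2 with h | h
    · rw [psiError, indicator_of_notMem (by simpa using h), indicator_of_mem (by simpa using h),
        Chebyshev.psi_eq_zero_of_lt_two h]
      simp
    · rw [psiError, indicator_of_mem (by simpa using h), indicator_of_notMem (by simpa using h)]
      simp [sub_eq_add_neg]
  rw [sub_add_cancel] at h1
  rw [h6, h5, h4, h3, h2, h1]
  push_cast
  ring

/-- The measure `k(x) dx / x` on `(1, ∞)`. -/
noncomputable def mellinMeasure (k : ℝ → ℝ) : Measure ℝ :=
  (volume.restrict (Ioi 1)).withDensity fun x ↦ ENNReal.ofReal (k x / x)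

lemma ae_neg_log_nonpos (k : ℝ → ℝ) : ∀ᵐ x ∂mellinMeasure k, -Real.log x ≤ 0 := by
  refine (withDensity_absolutelyContinuous _ _).ae_le ?_
  filter_upwards [ae_restrict_mem measurableSet_Ioi] with x hx
  have : (1 : ℝ) < x := hx
  linarith [Real.log_pos this]

lemma measurable_ofReal_div {k : ℝ → ℝ} (hk : Measurable k) :
    Measurable fun x : ℝ ↦ ENNReal.ofReal (k x / x) :=
  (hk.div measurable_id).ennreal_ofReal

lemma exp_mul_neg_log_mul_div {x : ℝ} (hx : 1 < x) (k : ℝ) (s : ℂ) :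
    ((k / x : ℝ) : ℂ) * Complex.exp (s * ((-Real.log x : ℝ) : ℂ)) =
      k * (x : ℂ) ^ (-(s + 1)) := by
  have h0 : (x : ℂ) ≠ 0 := by exact_mod_cast (by linarith : x ≠ 0)
  rw [neg_add', Complex.cpow_sub _ _ h0, Complex.cpow_one, Complex.cpow_def_of_ne_zero h0,
    ← Complex.ofReal_log (by linarith)]
  push_cast
  rw [show (Real.log x : ℂ) * -s = s * -(Real.log x : ℂ) by ring]
  ring

lemma complexMGF_mellinMeasure {k : ℝ → ℝ} (hk : Measurable k) (h0 : ∀ x, 1 < x → 0 ≤ k x)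
    (s : ℂ) : complexMGF (fun x ↦ -Real.log x) (mellinMeasure k) s = tailMellin k (s + 1) := by
  rw [complexMGF, mellinMeasure, integral_withDensity_eq_integral_toReal_smul
    (measurable_ofReal_div hk) (ae_of_all _ fun _ ↦ ENNReal.ofReal_lt_top), tailMellin]
  refine setIntegral_congr_fun measurableSet_Ioi fun x hx ↦ ?_
  have hx : 1 < x := hx
  rw [ENNReal.toReal_ofReal (div_nonneg (h0 x hx) (by linarith)), Complex.real_smul,
    exp_mul_neg_log_mul_div hx]

lemma Ioi_subset_integrableExpSet_mellinMeasure {k : ℝ → ℝ} {m : ℝ} (hk : PowerBounded k m)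
    (h0 : ∀ x, 1 < x → 0 ≤ k x) :
    Ioi m ⊆ integrableExpSet (fun x ↦ -Real.log x) (mellinMeasure k) := by
  intro σ hσ
  have hσ : m < σ := hσ
  have h := (hk.integrableOn (s := σ + 1) (by simpa using hσ)).re
  rw [integrableExpSet, mem_ofPred_eq, mellinMeasure, integrable_withDensity_iff_integrable_smul'
    (measurable_ofReal_div hk.1) (ae_of_all _ fun _ ↦ ENNReal.ofReal_lt_top)]
  refine h.congr ?_
  filter_upwards [ae_restrict_mem measurableSet_Ioi] with x hx
  have hx : 1 < x := hx
  rw [ENNReal.toReal_ofReal (div_nonneg (h0 x hx) (by linarith)),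
    ← exp_mul_neg_log_mul_div hx, smul_eq_mul, ← Complex.ofReal_mul, ← Complex.ofReal_exp,
    ← Complex.ofReal_mul]
  exact Complex.ofReal_re _

/-- A one-sided bound for the smoothed error term forces a zero-free half-plane. -/
theorem riemannZeta₁_ne_zero_of_weightedError_le {c η : ℝ} (hc : 0 ≤ c) (hc1 : c < 1)
    (hη : η ^ 2 = 1) (h : ∀ᶠ x in atTop, η * weightedError x ≤ x ^ (1 + c)) {z : ℂ}
    (hz : c < z.re) : riemannZeta₁ z ≠ 0 := by
  obtain ⟨X₀, hX₀⟩ := eventually_atTop.1 h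
  set f : ℝ → ℝ := fun x ↦ x ^ (1 + c) + -η * weightedError x with hf
  have hfb : PowerBounded f 2 := ((powerBounded_rpow (1 + c)).mono (by linarith)).add
    (powerBounded_weightedError.const_mul _)
  set k : ℝ → ℝ := (Ioi X₀).indicator f with hk
  set l : ℝ → ℝ := (Iic X₀).indicator f with hl
  have hkb : PowerBounded k 2 := hfb.indicator measurableSet_Ioi
  have hlb : ∀ m, PowerBounded l m := fun m ↦ hfb.indicator_Iic X₀ m
  have hk0 : ∀ x, 1 < x → 0 ≤ k x := by
    intro x _
    refine indicator_nonneg (fun y hy ↦ ?_) x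
    have := hX₀ y (le_of_lt hy)
    simp only [hf]; linarith
  have hε := differentiable_tailMellin powerBounded_low
  have hle := differentiable_tailMellin hlb
  have hshift : Differentiable ℂ fun s : ℂ ↦ s - 1 := differentiable_id.sub_const 1
  have hη0 : (η : ℂ) ≠ 0 := by
    rintro h0
    rw [Complex.ofReal_eq_zero.1 h0] at hη
    norm_num at hη
  have hη2 : (η : ℂ) ^ 2 = 1 := by exact_mod_cast hη
  have hMGF := complexMGF_mellinMeasure hkb.1 hk0
  -- the transform of the weighted error in terms of the moment generating function
  have hkey : ∀ s : ℂ, 2 < s.re → s * η * ((s - (1 + c))⁻¹ - tailMellin l (s + 1)) -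
      η * s * complexMGF (fun x ↦ -Real.log x) (mellinMeasure k) s =
      tailMellin (fun t ↦ liSqDeriv₂ t * psiError t) s := by
    intro s hs
    have hs1 : 2 + 1 < (s + 1).re := by simpa [add_comm] using (by linarith : (2 : ℝ) + 1 < s.re + 1)
    have e1 := mul_tailMellin_primitive powerBounded_weight_mul_psiError hs
    have e2 := ((powerBounded_rpow (1 + c)).mono (by linarith : 1 + c ≤ 2)).tailMellin_add
      (powerBounded_weightedError.const_mul (-η)) hs1
    have e3 := (hlb 2).tailMellin_add hkb hs1
    have e4 : tailMellin f (s + 1) = tailMellin (fun t ↦ l t + k t) (s + 1) := by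
      refine tailMellin_congr (fun t _ ↦ ?_) _
      rcases le_or_gt t X₀ with ht | ht
      · simp [hl, hk, ht]
      · simp [hl, hk, ht]
    have e5 := tailMellin_rpow (m := 1 + c) (s := s + 1) (by linarith)
    have e6 := tailMellin_const_mul weightedError (-η) (s + 1)
    rw [e5, e6] at e2
    rw [← e1, hMGF]
    change _ = s * tailMellin weightedError (s + 1)
    have e7 : (s + 1 - ((1 + c : ℝ) : ℂ) - 1)⁻¹ = (s - (1 + c))⁻¹ := by
      push_cast; congr 1; ring
    rw [e7] at e2
    have e8 : tailMellin l (s + 1) + tailMellin k (s + 1) =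
        (s - (1 + c))⁻¹ + ((-η : ℝ) : ℂ) * tailMellin weightedError (s + 1) := by
      rw [← e3, ← e4, ← e2]
    push_cast at e8
    linear_combination (-s * η) * e8 + s * tailMellin weightedError (s + 1) * hη2
  have hmain := ne_zero_of_nonpos_complexMGF (μ := mellinMeasure k) (X := fun x ↦ -Real.log x)
    (Real.measurable_log.neg.aemeasurable) (ae_neg_log_nonpos k)
    (Z := fun s ↦ riemannZeta₁ (s - 1)) (ε := tailMellin ((Iio 2).indicator fun t : ℝ ↦ t))
    (D := tailMellin psiError)
    (E := fun s ↦ s * η * ((s - (1 + c))⁻¹ - tailMellin l (s + 1))) (τ := 1 + c) (T := 2)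
    (η := η) (by linarith) (by linarith) hη0 (differentiable_riemannZeta₁.comp hshift) hε ?_ ?_
    (Ioi_subset_integrableExpSet_mellinMeasure hkb hk0) ?_ ?_ ?_ (s := z + 1)
    (by simp; linarith)
  · simpa using hmain
  · intro s hs
    have hne : s - (1 + c) ≠ 0 := by
      intro h0
      have := congrArg Complex.re h0
      simp at this
      have hs : 1 + c < s.re := hs
      linarith
    have h1 : DifferentiableAt ℂ (fun s ↦ tailMellin l (s + 1)) s :=
      (hle.comp (differentiable_id.add_const 1)) s
    exact ((((differentiableAt_id.mul_const (η : ℂ))).fun_mul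
      (((differentiableAt_id.sub_const (1 + c : ℂ)).fun_inv hne).fun_sub h1))).differentiableWithinAt
  · intro x hx
    have := riemannZeta₁_ofReal_ne_zero (σ := x - 1) (by linarith)
    simpa using this
  · intro s hs
    have hs : 2 < s.re := hs
    exact (powerBounded_psiError.hasDerivAt_tailMellin (by linarith)).differentiableAt.differentiableWithinAt
  · intro s hs
    have h1 : s - 1 ≠ 0 := by
      intro h0
      have := congrArg Complex.re h0
      simp at this
      linarith
    have h2 : riemannZeta₁ (s - 1) ≠ 0 := by
      have h3 : s - 1 ≠ 1 := by
        intro h0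
        have := congrArg Complex.re h0
        simp at this
        linarith
      rw [riemannZeta₁_eq_sub_mul h3]
      exact mul_ne_zero (sub_ne_zero.2 h3) (riemannZeta_ne_zero_of_one_lt_re (by simp; linarith))
    have h4 : deriv (fun s ↦ riemannZeta₁ (s - 1)) s = deriv riemannZeta₁ (s - 1) := by
      rw [deriv_comp_sub_const]
    rw [h4, tailMellin_psiError hs]
    field_simp
    ring
  · intro s hs
    have h1 : (fun s ↦ s * η * ((s - (1 + c))⁻¹ - tailMellin l (s + 1)) -
        η * s * complexMGF (fun x ↦ -Real.log x) (mellinMeasure k) s) =ᶠ[𝓝 s]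
        tailMellin (fun t ↦ liSqDeriv₂ t * psiError t) := by
      filter_upwards [(isOpen_lt_re 2).mem_nhds hs] with w hw using hkey w hw
    rw [h1.deriv.deriv_eq, deriv_deriv_tailMellin powerBounded_weight_mul_psiError (by linarith),
      tailMellin_log_log_weight hs]

/-- The sum of the primes `p ≤ x`. -/
noncomputable def primeSum (x : ℝ) : ℕ := ∑ p ∈ Finset.Icc 0 ⌊x⌋₊ with p.Prime, p

lemma log_pos_of_two_le {t : ℝ} (ht : 2 ≤ t) : 0 < Real.log t := Real.log_pos (by linarith)

lemma hasDerivAt_div_log {t : ℝ} (ht : 1 < t) :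
    HasDerivAt (fun t ↦ t / Real.log t) (liSqDeriv₂ t) t := by
  have h0 : Real.log t ≠ 0 := (Real.log_pos ht).ne'
  refine ((hasDerivAt_id t).fun_div (Real.hasDerivAt_log (by linarith)) h0).congr_deriv ?_
  rw [liSqDeriv₂]
  simp only [id]
  field_simp

lemma continuousOn_liSqDeriv₂ : ContinuousOn liSqDeriv₂ (Ioi 1) := by
  intro t ht
  have ht : 1 < t := ht
  have h0 : Real.log t ^ 2 ≠ 0 := pow_ne_zero _ (Real.log_pos ht).ne'
  have h1 : t ≠ 0 := by linarith
  exact (((Real.continuousAt_log h1).sub continuousAt_const).div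
    ((Real.continuousAt_log h1).pow 2) h0).continuousWithinAt

lemma continuousOn_liSqDeriv₂_uIcc {x : ℝ} (hx : 2 ≤ x) :
    ContinuousOn liSqDeriv₂ (uIcc 2 x) := by
  refine continuousOn_liSqDeriv₂.mono fun t ht ↦ ?_
  rw [uIcc_of_le hx] at ht
  exact one_lt_two.trans_le ht.1

lemma intervalIntegrable_liSqDeriv₂_mul_theta {x : ℝ} (hx : 2 ≤ x) :
    IntervalIntegrable (fun t ↦ liSqDeriv₂ t * Chebyshev.theta t) volume 2 x :=
  (Chebyshev.theta_mono.intervalIntegrable).continuousOn_mul (continuousOn_liSqDeriv₂_uIcc hx)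

lemma primeSum_eq {x : ℝ} (hx : 2 ≤ x) : (primeSum x : ℝ) =
    x / Real.log x * Chebyshev.theta x - ∫ t in (2)..x, liSqDeriv₂ t * Chebyshev.theta t := by
  let a : ℕ → ℝ := fun n ↦ if n.Prime then Real.log n else 0
  have ha : ∀ t : ℝ, ∑ k ∈ Finset.Icc 0 ⌊t⌋₊, a k = Chebyshev.theta t := fun t ↦ by
    rw [Chebyshev.theta_eq_sum_Icc, Finset.sum_filter]
  have h1 : (primeSum x : ℝ) =
      ∑ k ∈ Finset.Icc 0 ⌊x⌋₊, (fun t : ℝ ↦ t / Real.log t) k * a k := by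
    rw [primeSum, Finset.sum_filter]
    push_cast
    refine Finset.sum_congr rfl fun p _ ↦ ?_
    simp only [a]
    split_ifs with hp
    · have : Real.log p ≠ 0 := (Real.log_pos (by exact_mod_cast hp.one_lt)).ne'
      field_simp
    · simp
  have hd : ∀ t ∈ Icc 2 x, deriv (fun t : ℝ ↦ t / Real.log t) t = liSqDeriv₂ t :=
    fun t ht ↦ (hasDerivAt_div_log (one_lt_two.trans_le ht.1)).deriv
  rw [h1, sum_mul_eq_sub_integral_mul₁ (f := fun t : ℝ ↦ t / Real.log t) a
    (by simp [a]) (by simp [a, Nat.not_prime_one]), ha, ← intervalIntegral.integral_of_le hx]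
  · congr 1
    refine intervalIntegral.integral_congr fun t ht ↦ ?_
    rw [uIcc_of_le hx] at ht
    simp only [ha, hd t ht]
  · exact fun t ht ↦ (hasDerivAt_div_log (one_lt_two.trans_le ht.1)).differentiableAt
  · refine (ContinuousOn.integrableOn_Icc ?_).congr_fun (fun t ht ↦ (hd t ht).symm)
      measurableSet_Icc
    exact continuousOn_liSqDeriv₂.mono fun t ht ↦ one_lt_two.trans_le ht.1

lemma hasDerivAt_comp_sq {li : ℝ → ℝ}
    (hderiv : ∀ x : ℝ, 1 < x → HasDerivAt li (1 / Real.log x) x) {t : ℝ} (ht : 1 < t) :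
    HasDerivAt (fun t ↦ li (t ^ 2)) (t / Real.log t) t := by
  have h0 : Real.log t ≠ 0 := (Real.log_pos ht).ne'
  refine ((hderiv (t ^ 2) (by nlinarith)).comp t (hasDerivAt_pow 2 t)).congr_deriv ?_
  rw [Real.log_pow]
  field_simp
  norm_num

lemma li_sq_sub_eq {li : ℝ → ℝ}
    (hderiv : ∀ x : ℝ, 1 < x → HasDerivAt li (1 / Real.log x) x) {x : ℝ} (hx : 2 ≤ x) :
    li (x ^ 2) - x / Real.log x * x =
      li (2 ^ 2) - 2 / Real.log 2 * 2 - ∫ t in (2)..x, liSqDeriv₂ t * t := by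
  have := intervalIntegral.integral_eq_sub_of_hasDerivAt
    (f := fun t ↦ li (t ^ 2) - t / Real.log t * t) (f' := fun t ↦ -(liSqDeriv₂ t * t))
    (a := 2) (b := x) (fun t ht ↦ ?_) ?_
  · rw [intervalIntegral.integral_neg] at this
    linarith
  · rw [uIcc_of_le hx] at ht
    have ht1 : 1 < t := one_lt_two.trans_le ht.1
    refine ((hasDerivAt_comp_sq hderiv ht1).sub
      ((hasDerivAt_div_log ht1).mul (hasDerivAt_id t))).congr_deriv ?_
    simp
  · exact ((continuousOn_liSqDeriv₂_uIcc hx).mul continuousOn_id).neg.intervalIntegrable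

/-- The weighted error term for the primes is that of the prime powers, up to `O(x^{3/2} log x)`. -/
lemma exists_abs_sub_weightedError_le {li : ℝ → ℝ}
    (hderiv : ∀ x : ℝ, 1 < x → HasDerivAt li (1 / Real.log x) x) :
    ∃ K : ℝ, ∀ x : ℝ, 2 ≤ x → |li (x ^ 2) + x / Real.log x * (Chebyshev.theta x - x) - primeSum x -
      weightedError x| ≤ K + 8 * √x * Real.log x * x := by
  set w : ℝ → ℝ := fun t ↦ liSqDeriv₂ t * psiError t
  have hw : ∀ a b, IntervalIntegrable w volume a b := fun a b ↦
    powerBounded_weight_mul_psiError.intervalIntegrable zero_le_one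
      (fun _ ht ↦ weight_mul_psiError_eq_zero ht) a b
  refine ⟨|li (2 ^ 2) - 2 / Real.log 2 * 2 - ∫ t in (1)..2, w t|, fun x hx ↦ ?_⟩
  have h1 : weightedError x = (∫ t in (1)..2, w t) + ∫ t in (2)..x, w t :=
    (intervalIntegral.integral_add_adjacent_intervals (hw 1 2) (hw 2 x)).symm
  have hid : IntervalIntegrable (fun t ↦ liSqDeriv₂ t * t) volume 2 x :=
    ((continuousOn_liSqDeriv₂_uIcc hx).mul continuousOn_id).intervalIntegrable
  have hθ := intervalIntegrable_liSqDeriv₂_mul_theta hx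
  have h2 : (∫ t in (2)..x, w t) - ((∫ t in (2)..x, liSqDeriv₂ t * Chebyshev.theta t) -
      ∫ t in (2)..x, liSqDeriv₂ t * t) =
      ∫ t in (2)..x, liSqDeriv₂ t * (Chebyshev.psi t - Chebyshev.theta t) := by
    rw [← intervalIntegral.integral_sub hθ hid,
      ← intervalIntegral.integral_sub (hw 2 x) (hθ.sub hid)]
    refine intervalIntegral.integral_congr fun t ht ↦ ?_
    rw [uIcc_of_le hx] at ht
    simp only [w, psiError, indicator_of_mem (show t ∈ Ici 2 from ht.1)]
    ring
  have h3 : |∫ t in (2)..x, liSqDeriv₂ t * (Chebyshev.psi t - Chebyshev.theta t)| ≤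
      8 * √x * Real.log x * x := by
    have hlog := log_pos_of_two_le hx
    have h := intervalIntegral.norm_integral_le_of_norm_le_const
      (f := fun t ↦ liSqDeriv₂ t * (Chebyshev.psi t - Chebyshev.theta t)) (a := 2) (b := x)
      (C := 8 * √x * Real.log x) fun t ht ↦ ?_
    · refine h.trans ?_
      rw [abs_of_nonneg (by linarith)]
      have : 0 ≤ 8 * √x * Real.log x := by positivity
      nlinarith
    · rw [uIoc_of_le hx] at ht
      have e1 := Chebyshev.psi_sub_theta_le (x := t) (by linarith [ht.1])
      have e2 := Chebyshev.theta_le_psi t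
      have e3 : √t ≤ √x := Real.sqrt_le_sqrt ht.2
      have e4 : Real.log t ≤ Real.log x := Real.log_le_log (by linarith [ht.1]) ht.2
      have e5 := log_pos_of_two_le ht.1.le
      have e6 : √t * Real.log t ≤ √x * Real.log x := by gcongr
      rw [Real.norm_eq_abs, abs_mul, abs_of_nonneg (sub_nonneg.2 e2)]
      calc _ ≤ 4 * (Chebyshev.psi t - Chebyshev.theta t) := by
            gcongr
            exact abs_liSqDeriv₂_le ht.1.le
        _ ≤ _ := by linarith
  have h4 := primeSum_eq hx
  have h5 := li_sq_sub_eq hderiv hx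
  have h6 : li (x ^ 2) + x / Real.log x * (Chebyshev.theta x - x) - primeSum x -
      weightedError x = (li (2 ^ 2) - 2 / Real.log 2 * 2 - ∫ t in (1)..2, w t) -
      ∫ t in (2)..x, liSqDeriv₂ t * (Chebyshev.psi t - Chebyshev.theta t) := by
    rw [h1, ← h2, h4]
    linear_combination h5
  rw [h6]
  exact (abs_sub _ _).trans (add_le_add le_rfl h3)

/-- The error in `primeSum x ≈ li (x ^ 2)`, corrected by the first-order effect of `θ x - x`. -/
noncomputable def liSqError (li : ℝ → ℝ) (x : ℝ) : ℝ :=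
  li (x ^ 2) + x / Real.log x * (Chebyshev.theta x - x) - primeSum x

lemma rpow_isLittleO_rpow {a b : ℝ} (h : a < b) :
    (fun x : ℝ ↦ x ^ a) =o[atTop] fun x ↦ x ^ b := by
  rw [Asymptotics.isLittleO_iff_tendsto']
  · refine (tendsto_rpow_neg_atTop (sub_pos.2 h)).congr' ?_
    filter_upwards [eventually_gt_atTop 0] with x hx
    rw [← Real.rpow_sub hx, neg_sub]
  · filter_upwards [eventually_gt_atTop 0] with x hx hx0
    exact absurd hx0 (Real.rpow_pos_of_pos hx b).ne'

lemma sqrt_mul_log_isLittleO_rpow {c : ℝ} (hc : 1 / 2 < c) :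
    (fun x : ℝ ↦ √x * Real.log x) =o[atTop] fun x ↦ x ^ c := by
  refine ((Asymptotics.isBigO_refl (fun x : ℝ ↦ √x) atTop).mul_isLittleO
    (isLittleO_log_rpow_atTop (sub_pos.2 hc))).congr' .rfl ?_
  filter_upwards [eventually_gt_atTop 0] with x hx
  rw [Real.sqrt_eq_rpow, ← Real.rpow_add hx]
  ring_nf

lemma eventually_const_add_le_rpow (K : ℝ) {c d : ℝ} (hc : 1 / 2 < c) (hd : c < d) :
    ∀ᶠ x : ℝ in atTop, K + 8 * √x * Real.log x * x + x ^ (1 + c) ≤ x ^ (1 + d) := by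
  have h1 : (fun _ : ℝ ↦ K) =o[atTop] fun x : ℝ ↦ x ^ (1 + d) :=
    Asymptotics.isLittleO_const_left.2 (.inr <| tendsto_norm_atTop_atTop.comp <|
      tendsto_rpow_atTop (by linarith))
  have h2 : (fun x : ℝ ↦ 8 * √x * Real.log x * x) =o[atTop] fun x : ℝ ↦ x ^ (1 + d) := by
    refine (((sqrt_mul_log_isLittleO_rpow (hc.trans hd)).mul_isBigO
      (Asymptotics.isBigO_refl (fun x : ℝ ↦ x) atTop)).const_mul_left 8).congr' ?_ ?_
    · exact .of_forall fun x ↦ by ring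
    · filter_upwards [eventually_gt_atTop 0] with x hx
      rw [Real.rpow_add hx, Real.rpow_one, mul_comm]
  have h3 : (fun x : ℝ ↦ x ^ (1 + c)) =o[atTop] fun x : ℝ ↦ x ^ (1 + d) :=
    rpow_isLittleO_rpow (by linarith)
  filter_upwards [((h1.add h2).add h3).bound one_pos, eventually_gt_atTop 0] with x hx h0
  rw [one_mul, Real.norm_eq_abs, Real.norm_eq_abs, abs_of_pos (Real.rpow_pos_of_pos h0 _)] at hx
  exact (le_abs_self _).trans hx

lemma exists_frequently_rpow_le_liSqError {li : ℝ → ℝ}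
    (hderiv : ∀ x : ℝ, 1 < x → HasDerivAt li (1 / Real.log x) x) (h : ¬ RiemannHypothesis) :
    ∃ c : ℝ, 1 / 2 < c ∧ ∀ η : ℝ, η ^ 2 = 1 →
      ∃ᶠ x : ℝ in atTop, x ^ (1 + c) ≤ η * liSqError li x := by
  obtain ⟨ρ, hρ, hz⟩ := exists_zero_of_not_riemannHypothesis h
  obtain ⟨d, hd, hdρ⟩ := exists_between (show (1 / 2 : ℝ) < min ρ.re 1 from
    lt_min hρ (by norm_num))
  obtain ⟨c, hc, hcd⟩ := exists_between hd
  refine ⟨c, hc, fun η hη ↦ ?_⟩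
  obtain ⟨K, hK⟩ := exists_abs_sub_weightedError_le hderiv
  have hfr : ∃ᶠ x : ℝ in atTop, x ^ (1 + d) < η * weightedError x := by
    intro hev
    exact riemannZeta₁_ne_zero_of_weightedError_le (by linarith)
      (hdρ.trans_le (min_le_right _ _)) hη (hev.mono fun x hx ↦ not_lt.1 hx)
      (hdρ.trans_le (min_le_left _ _)) hz
  refine (hfr.and_eventually ((eventually_const_add_le_rpow K hc hcd).and
    (eventually_ge_atTop 2))).mono fun x ⟨h1, h2, h3⟩ ↦ ?_
  have h4 := hK x h3
  rw [abs_le] at h4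
  rw [liSqError]
  rcases sq_eq_one_iff.1 hη with rfl | rfl <;> linarith

lemma primeSum_eq_sum_primesLE (x : ℝ) : primeSum x = ∑ p ∈ Nat.primesLE ⌊x⌋₊, p := by
  rw [primeSum, Nat.primesLE_eq_filter_Icc_zero]

lemma ell_primorial (n : ℕ) : ell (primorial n) = ∑ p ∈ Nat.primesLE n, p := by
  rw [ell, primeFactors_primorial]
  refine Finset.sum_congr rfl fun p hp ↦ ?_
  have hp' := Nat.mem_primesLE.1 hp
  rw [Nat.factorization_eq_one_of_squarefree (squarefree_primorial n) hp'.2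
    (hp'.2.dvd_primorial_iff.2 hp'.1), pow_one]

lemma primeSum_le {x : ℝ} (hx : 1 ≤ x) : (primeSum x : ℝ) ≤ 2 * x ^ 2 := by
  have hf : (⌊x⌋₊ : ℝ) ≤ x := Nat.floor_le (by linarith)
  have h1 : (primeSum x : ℝ) ≤ ∑ p ∈ Finset.Icc 0 ⌊x⌋₊, (⌊x⌋₊ : ℝ) := by
    rw [primeSum]
    push_cast
    refine (Finset.sum_le_sum fun p hp ↦ ?_).trans
      (Finset.sum_le_sum_of_subset_of_nonneg (Finset.filter_subset _ _) fun _ _ _ ↦ by positivity)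
    exact_mod_cast (Finset.mem_Icc.1 (Finset.mem_filter.1 hp).1).2
  rw [Finset.sum_const, Nat.card_Icc, nsmul_eq_mul] at h1
  push_cast at h1
  nlinarith [Nat.cast_nonneg (α := ℝ) ⌊x⌋₊]

lemma theta_le_primeSum (x : ℝ) : Chebyshev.theta x ≤ primeSum x := by
  rw [Chebyshev.theta_eq_sum_primesLE, primeSum_eq_sum_primesLE]
  push_cast
  exact Finset.sum_le_sum fun p _ ↦ Real.log_le_self p.cast_nonneg

lemma tendsto_theta_atTop : Tendsto Chebyshev.theta atTop atTop := by
  refine tendsto_atTop_mono (fun x ↦ ?_)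
    (Real.tendsto_log_atTop.comp (tendsto_natCast_atTop_atTop.comp tendsto_nat_floor_atTop))
  rw [Chebyshev.theta_eq_log_primorial]
  rcases Nat.eq_zero_or_pos ⌊x⌋₊ with h | h
  · simp [h]
  · exact Real.log_le_log (by simpa using h) (Nat.cast_le.2 le_primorial_self)

lemma tendsto_primeSum_atTop : Tendsto primeSum atTop atTop :=
  tendsto_natCast_atTop_iff.1 (tendsto_atTop_mono theta_le_primeSum tendsto_theta_atTop)

lemma log_le_mul_of_ge {x t : ℝ} (hx : 4 ≤ x) (ht : x ≤ t) :
    Real.log t ≤ Real.log x / x * t := by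
  have he := Real.exp_one_lt_three
  have := Real.log_div_self_antitoneOn (mem_Ici.2 (by linarith : Real.exp 1 ≤ x))
    (mem_Ici.2 (by linarith : Real.exp 1 ≤ t)) ht
  rwa [div_le_iff₀ (by linarith)] at this

lemma mul_le_log_of_le {x : ℝ} {p : ℕ} (hx : 4 ≤ x) (hp : 2 ≤ p) (hpx : p ≤ x) :
    Real.log x / x * p ≤ Real.log p := by
  have he := Real.exp_one_lt_three
  rw [← le_div_iff₀ (by positivity)]
  obtain rfl | hp3 := hp.eq_or_lt
  · have h4 : Real.log 4 / 4 = Real.log (2 : ℕ) / (2 : ℕ) := by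
      rw [show (4 : ℝ) = 2 ^ 2 by norm_num, Real.log_pow]
      push_cast
      ring
    rw [← h4]
    exact Real.log_div_self_antitoneOn (mem_Ici.2 (by linarith)) (mem_Ici.2 (by linarith)) hx
  · have hp3 : (3 : ℝ) ≤ p := by exact_mod_cast hp3
    exact Real.log_div_self_antitoneOn (mem_Ici.2 (by linarith)) (mem_Ici.2 (by linarith)) hpx

lemma mul_log_sub_le {x : ℝ} {p a : ℕ} (hx : 4 ≤ x) (hp : 2 ≤ p) (ha : a ≠ 0) (hpx : p ≤ x) :
    a * Real.log p - Real.log x / x * (p ^ a : ℕ) ≤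
      (Real.log p - Real.log x / x * p) + if p ≤ √x then Real.log x else 0 := by
  have h0 := mul_le_log_of_le hx hp hpx
  have hlog : 0 ≤ Real.log x := Real.log_nonneg (by linarith)
  rw [← Real.log_pow, ← Nat.cast_pow]
  rcases le_or_gt x (p ^ a : ℕ) with h | h
  · have h1 := log_le_mul_of_ge hx h
    have : (0 : ℝ) ≤ if p ≤ √x then Real.log x else 0 := by split_ifs <;> simp [hlog]
    linarith
  · split_ifs with hs
    · have h1 : Real.log (p ^ a : ℕ) ≤ Real.log x := Real.log_le_log (by positivity) h.le
      have : 0 ≤ Real.log x / x * (p ^ a : ℕ) := by positivity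
      linarith
    · have ha1 : a = 1 := by
        by_contra hne
        have h2 : p ^ 2 ≤ p ^ a := Nat.pow_le_pow_right (by omega) (by omega)
        have h3 : (p : ℝ) ^ 2 ≤ (p ^ a : ℕ) := by exact_mod_cast h2
        exact hs (Real.le_sqrt_of_sq_le (h3.trans h.le))
      simp [ha1]

/-- Linear-programming upper bound for `log M` in terms of `ell M`. -/
lemma log_le_add_mul_ell {x : ℝ} (hx : 4 ≤ x) {M : ℕ} (hM : M ≠ 0) :
    Real.log M ≤ Real.log x / x * (ell M - primeSum x) + Chebyshev.theta x + √x * Real.log x := by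
  have hlog : 0 ≤ Real.log x := Real.log_nonneg (by linarith)
  set h : ℕ → ℝ := fun p ↦
    (Real.log p - Real.log x / x * p) + if p ≤ √x then Real.log x else 0 with hh
  have h0 : ∀ p ∈ Nat.primesLE ⌊x⌋₊, 0 ≤ h p := fun p hp ↦ by
    have hp' := Nat.mem_primesLE.1 hp
    have := mul_le_log_of_le hx hp'.2.two_le ((Nat.le_floor_iff (by linarith)).1 hp'.1)
    have h2 : (0 : ℝ) ≤ if p ≤ √x then Real.log x else 0 := by split_ifs <;> simp [hlog]
    simp only [h]
    linarith
  have h1 : Real.log M - Real.log x / x * ell M ≤ ∑ p ∈ M.primeFactors with p ≤ ⌊x⌋₊, h p := by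
    rw [Real.log_nat_eq_sum_factorization, Finsupp.sum, Nat.support_factorization, ell,
      Nat.cast_sum, Finset.mul_sum, ← Finset.sum_sub_distrib, Finset.sum_filter]
    refine Finset.sum_le_sum fun p hp ↦ ?_
    have hpp := Nat.prime_of_mem_primeFactors hp
    have ha : M.factorization p ≠ 0 :=
      (hpp.factorization_pos_of_dvd hM (Nat.dvd_of_mem_primeFactors hp)).ne'
    split_ifs with hpx
    · exact mul_log_sub_le hx hpp.two_le ha ((Nat.le_floor_iff (by linarith)).1 hpx)
    · rw [sub_nonpos, ← Real.log_pow, ← Nat.cast_pow]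
      refine log_le_mul_of_ge hx ((Nat.lt_of_floor_lt (not_le.1 hpx)).le.trans ?_)
      exact_mod_cast Nat.le_self_pow ha p
  have h2 : ∑ p ∈ M.primeFactors with p ≤ ⌊x⌋₊, h p ≤ ∑ p ∈ Nat.primesLE ⌊x⌋₊, h p := by
    refine Finset.sum_le_sum_of_subset_of_nonneg (fun p hp ↦ ?_) fun p hp _ ↦ h0 p hp
    have hp' := Finset.mem_filter.1 hp
    exact Nat.mem_primesLE.2 ⟨hp'.2, Nat.prime_of_mem_primeFactors hp'.1⟩
  have h3 : ∑ p ∈ Nat.primesLE ⌊x⌋₊, (if (p : ℝ) ≤ √x then Real.log x else 0) ≤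
      √x * Real.log x := by
    rw [← Finset.sum_filter, Finset.sum_const, nsmul_eq_mul]
    gcongr
    refine le_trans ?_ (Nat.floor_le (Real.sqrt_nonneg x))
    rw [Nat.cast_le, ← Nat.add_sub_cancel ⌊√x⌋₊ 1, ← Nat.card_Icc]
    refine Finset.card_le_card fun p hp ↦ ?_
    have hp' := Finset.mem_filter.1 hp
    exact Finset.mem_Icc.2 ⟨(Nat.prime_of_mem_primesLE hp'.1).one_le, Nat.le_floor hp'.2⟩
  have h4 : ∑ p ∈ Nat.primesLE ⌊x⌋₊, h p = Chebyshev.theta x - Real.log x / x * primeSum x +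
      ∑ p ∈ Nat.primesLE ⌊x⌋₊, (if (p : ℝ) ≤ √x then Real.log x else 0) := by
    simp only [hh]
    rw [Finset.sum_add_distrib, Finset.sum_sub_distrib, ← Finset.mul_sum,
      Chebyshev.theta_eq_sum_primesLE, primeSum_eq_sum_primesLE, Nat.cast_sum]
  linarith

lemma exists_li_sq_sub_eq {li : ℝ → ℝ}
    (hderiv : ∀ x : ℝ, 1 < x → HasDerivAt li (1 / Real.log x) x) {u v : ℝ} (hu : 1 < u)
    (huv : u < v) : ∃ ξ ∈ Ioo u v, li (v ^ 2) - li (u ^ 2) = ξ / Real.log ξ * (v - u) := by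
  obtain ⟨ξ, hξ, h⟩ := exists_hasDerivAt_eq_slope (fun t ↦ li (t ^ 2)) (fun t ↦ t / Real.log t)
    huv (fun t ht ↦ (hasDerivAt_comp_sq hderiv (hu.trans_le ht.1)).continuousAt.continuousWithinAt)
    fun t ht ↦ hasDerivAt_comp_sq hderiv (hu.trans ht.1)
  exact ⟨ξ, hξ, by rw [h, div_mul_cancel₀ _ (sub_pos.2 huv).ne']⟩

lemma sub_le_li_sq_sub {li : ℝ → ℝ}
    (hderiv : ∀ x : ℝ, 1 < x → HasDerivAt li (1 / Real.log x) x) {u v : ℝ} (hu : 1 < u)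
    (huv : u ≤ v) : v - u ≤ li (v ^ 2) - li (u ^ 2) := by
  obtain rfl | huv := huv.eq_or_lt
  · simp
  obtain ⟨ξ, hξ, h⟩ := exists_li_sq_sub_eq hderiv hu huv
  rw [h]
  refine le_mul_of_one_le_left (sub_pos.2 huv).le ?_
  rw [one_le_div (Real.log_pos (hu.trans hξ.1))]
  exact Real.log_le_self (by linarith [hξ.1])

lemma le_of_li_sq_le {li : ℝ → ℝ}
    (hderiv : ∀ x : ℝ, 1 < x → HasDerivAt li (1 / Real.log x) x) {u v : ℝ} (hv : 1 < v)
    (h : li (u ^ 2) ≤ li (v ^ 2)) : u ≤ v := by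
  by_contra! hlt
  linarith [sub_le_li_sq_sub hderiv hv hlt.le]

lemma li_sq_sub_le {li : ℝ → ℝ}
    (hderiv : ∀ x : ℝ, 1 < x → HasDerivAt li (1 / Real.log x) x) {u v : ℝ} (hu : Real.exp 1 ≤ u)
    (huv : u ≤ v) : li (v ^ 2) - li (u ^ 2) ≤ v * (v - u) := by
  obtain rfl | huv := huv.eq_or_lt
  · simp
  have he : 1 < Real.exp 1 := Real.one_lt_exp_iff.2 one_pos
  obtain ⟨ξ, hξ, h⟩ := exists_li_sq_sub_eq hderiv (he.trans_le hu) huv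
  rw [h]
  refine mul_le_mul_of_nonneg_right ?_ (sub_pos.2 huv).le
  refine (div_le_self (by linarith [hξ.1]) ?_).trans hξ.2.le
  rw [Real.le_log_iff_exp_le (by linarith [hξ.1])]
  linarith [hξ.1]

lemma div_log_le_div_log {u v : ℝ} (hu : Real.exp 1 ≤ u) (huv : u ≤ v) :
    u / Real.log u ≤ v / Real.log v := by
  have he : 1 < Real.exp 1 := Real.one_lt_exp_iff.2 one_pos
  have hu0 := Real.log_pos (he.trans_le hu)
  have hv0 := Real.log_pos (he.trans_le (hu.trans huv))
  have := Real.log_div_self_antitoneOn (mem_Ici.2 hu) (mem_Ici.2 (hu.trans huv)) huv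
  rw [div_le_div_iff₀ (by linarith) (by linarith)] at this
  rw [div_le_div_iff₀ hu0 hv0]
  linarith

/-- `t ↦ li (t ^ 2)` lies above its tangents on `[e, ∞)`. -/
lemma li_sq_add_mul_le {li : ℝ → ℝ}
    (hderiv : ∀ x : ℝ, 1 < x → HasDerivAt li (1 / Real.log x) x) {x z : ℝ}
    (hx : Real.exp 1 ≤ x) (hz : Real.exp 1 ≤ z) :
    li (x ^ 2) + x / Real.log x * (z - x) ≤ li (z ^ 2) := by
  have he : 1 < Real.exp 1 := Real.one_lt_exp_iff.2 one_pos
  rcases lt_trichotomy x z with h | rfl | h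
  · obtain ⟨ξ, hξ, hs⟩ := exists_li_sq_sub_eq hderiv (he.trans_le hx) h
    have := mul_le_mul_of_nonneg_right (div_log_le_div_log hx hξ.1.le) (sub_pos.2 h).le
    linarith
  · simp
  · obtain ⟨ξ, hξ, hs⟩ := exists_li_sq_sub_eq hderiv (he.trans_le hz) h
    have := mul_le_mul_of_nonneg_right (div_log_le_div_log (hz.trans hξ.1.le) hξ.2.le)
      (sub_pos.2 h).le
    linarith

lemma tendsto_li_sq_atTop {li : ℝ → ℝ}
    (hderiv : ∀ x : ℝ, 1 < x → HasDerivAt li (1 / Real.log x) x) :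
    Tendsto (fun x ↦ li (x ^ 2)) atTop atTop := by
  refine tendsto_atTop_mono' _ (f₁ := fun x ↦ x + (li (2 ^ 2) - 2)) ?_
    (tendsto_atTop_add_const_right _ _ tendsto_id)
  filter_upwards [eventually_ge_atTop 2] with x hx
  linarith [sub_le_li_sq_sub hderiv one_lt_two hx]

lemma exists_sqrt_liInv {li liInv : ℝ → ℝ} (hbij : Set.BijOn li (Set.Ioi 1) Set.univ)
    (hinv : ∀ x : ℝ, 1 < x → liInv (li x) = x) (s : ℝ) :
    1 < √(liInv s) ∧ li (√(liInv s) ^ 2) = s := by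
  obtain ⟨u, hu, rfl⟩ := hbij.surjOn (mem_univ s)
  have hu : 1 < u := hu
  rw [hinv u hu, Real.sq_sqrt (by linarith)]
  exact ⟨Real.lt_sqrt_of_sq_lt (by simpa using hu), rfl⟩

lemma exists_mul_log_rpow_le {c : ℝ} (hc : 1 / 2 < c) : ∃ b : ℝ, 1 / 4 < b ∧ ∃ ε : ℝ, 0 < ε ∧
    ∀ n : ℕ, ∀ x : ℝ, 1 ≤ x → (n : ℝ) ≤ 3 * x ^ 2 → ε * (n * Real.log n) ^ b ≤ x ^ c / 4 := by
  obtain ⟨b, hb, hbc⟩ := exists_between (show (1 / 4 : ℝ) < c / 2 by linarith)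
  have hb0 : 0 < b := by linarith
  set δ := c / (2 * b) - 1 with hδ
  have hδ0 : 0 < δ := by
    rw [hδ, sub_pos, one_lt_div (by linarith)]
    linarith
  have hbδ : b * (1 + δ) = c / 2 := by
    rw [hδ]
    field_simp
    ring
  refine ⟨b, hb, ((1 / δ) ^ b * 3 ^ (c / 2) * 4)⁻¹, by positivity, fun n x hx hn ↦ ?_⟩
  rw [inv_mul_le_iff₀ (by positivity)]
  rcases Nat.eq_zero_or_pos n with rfl | hn0
  · simp [Real.zero_rpow hb0.ne']
    positivity
  have hn1 : (0 : ℝ) < n := by exact_mod_cast hn0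
  have hlog : Real.log n ≤ n ^ δ / δ := Real.log_le_rpow_div hn1.le hδ0
  have hlog0 : 0 ≤ Real.log n := Real.log_natCast_nonneg n
  calc (n * Real.log n) ^ b ≤ (1 / δ * (n : ℝ) ^ (1 + δ)) ^ b := by
        refine Real.rpow_le_rpow (by positivity) ?_ hb0.le
        rw [Real.rpow_add hn1, Real.rpow_one]
        calc n * Real.log n ≤ n * (n ^ δ / δ) := by gcongr
          _ = _ := by ring
    _ = (1 / δ) ^ b * (n : ℝ) ^ (c / 2) := by
        rw [Real.mul_rpow (by positivity) (by positivity), ← Real.rpow_mul hn1.le, mul_comm _ b,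
          hbδ]
    _ ≤ (1 / δ) ^ b * (3 * x ^ 2) ^ (c / 2) := by gcongr
    _ = (1 / δ) ^ b * 3 ^ (c / 2) * 4 * (x ^ c / 4) := by
        rw [Real.mul_rpow (by positivity) (by positivity), ← Real.rpow_natCast x 2,
          ← Real.rpow_mul (by linarith)]
        push_cast
        rw [mul_div_cancel₀ c two_ne_zero]
        ring

lemma one_le_log_of_four_le {x : ℝ} (hx : 4 ≤ x) : 1 ≤ Real.log x := by
  rw [Real.le_log_iff_exp_le (by linarith)]
  linarith [Real.exp_one_lt_three]

lemma theta_le_log_of_isGreatest {x : ℝ} {m : ℕ}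
    (hm : IsGreatest {M : ℕ | 1 ≤ M ∧ ell M ≤ primeSum x} m) :
    Chebyshev.theta x ≤ Real.log m := by
  have h1 : primorial ⌊x⌋₊ ≤ m :=
    hm.2 ⟨primorial_pos _, by rw [ell_primorial, primeSum_eq_sum_primesLE]⟩
  rw [Chebyshev.theta_eq_log_primorial]
  exact Real.log_le_log (by exact_mod_cast primorial_pos _) (by exact_mod_cast h1)

lemma rpow_div_two_le_log_sub {g : ℕ → ℕ}
    (hg : ∀ n, IsGreatest {M : ℕ | 1 ≤ M ∧ ell M ≤ n} (g n)) {li liInv : ℝ → ℝ}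
    (hderiv : ∀ x : ℝ, 1 < x → HasDerivAt li (1 / Real.log x) x)
    (hbij : Set.BijOn li (Set.Ioi 1) Set.univ)
    (hinv : ∀ x : ℝ, 1 < x → liInv (li x) = x) {c x : ℝ} (hx : 4 ≤ x)
    (hθ : Real.exp 1 ≤ Chebyshev.theta x) (hp : li (Real.exp 1 ^ 2) ≤ primeSum x)
    (herr : x ^ (1 + c) ≤ liSqError li x) :
    x ^ c / 2 ≤ Real.log (g (primeSum x)) - √(liInv (primeSum x)) := by
  have he : 1 < Real.exp 1 := Real.one_lt_exp_iff.2 one_pos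
  have hgθ := theta_le_log_of_isGreatest (hg (primeSum x))
  obtain ⟨hy1, hy⟩ := exists_sqrt_liInv hbij hinv (primeSum x)
  set y := √(liInv (primeSum x))
  have htan := li_sq_add_mul_le hderiv (x := x) (by linarith [Real.exp_one_lt_three]) hθ
  rw [liSqError] at herr
  have hxc : 0 < x ^ (1 + c) := Real.rpow_pos_of_pos (by linarith) _
  have hye : Real.exp 1 ≤ y := le_of_li_sq_le hderiv hy1 (hy ▸ hp)
  have hyθ : y ≤ Chebyshev.theta x :=
    le_of_li_sq_le hderiv (he.trans_le hθ) (by rw [hy]; linarith)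
  have hup := li_sq_sub_le hderiv hye hyθ
  have hθx : Chebyshev.theta x ≤ 2 * x := by
    refine (Chebyshev.theta_le_log4_mul_x (by linarith)).trans ?_
    gcongr
    rw [show (4 : ℝ) = 2 ^ 2 by norm_num, Real.log_pow]
    push_cast
    linarith [Real.log_two_lt_d9]
  have h1 : x * x ^ c ≤ x * (2 * (Chebyshev.theta x - y)) := by
    rw [Real.rpow_add (by linarith), Real.rpow_one] at herr
    have := mul_le_mul_of_nonneg_right hθx (sub_nonneg.2 hyθ)
    linarith
  have := le_of_mul_le_mul_left h1 (by linarith)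
  linarith

lemma log_sub_le_neg_rpow {g : ℕ → ℕ}
    (hg : ∀ n, IsGreatest {M : ℕ | 1 ≤ M ∧ ell M ≤ n} (g n)) {li liInv : ℝ → ℝ}
    (hderiv : ∀ x : ℝ, 1 < x → HasDerivAt li (1 / Real.log x) x)
    (hbij : Set.BijOn li (Set.Ioi 1) Set.univ)
    (hinv : ∀ x : ℝ, 1 < x → liInv (li x) = x) {c x : ℝ} (hx : 4 ≤ x)
    (hli : 0 ≤ li (x ^ 2)) (herr : liSqError li x ≤ -x ^ (1 + c)) :
    Real.log (g ⌊li (x ^ 2)⌋₊) - √(liInv ⌊li (x ^ 2)⌋₊) ≤ -x ^ c + √x * Real.log x + 1 := by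
  set n := ⌊li (x ^ 2)⌋₊
  have hn1 : (n : ℝ) ≤ li (x ^ 2) := Nat.floor_le hli
  have hn2 : li (x ^ 2) < n + 1 := Nat.lt_floor_add_one _
  obtain ⟨hy1, hy⟩ := exists_sqrt_liInv hbij hinv n
  set y := √(liInv n)
  have hxy : x - 1 ≤ y := by
    refine le_of_li_sq_le hderiv hy1 ?_
    rw [hy]
    linarith [sub_le_li_sq_sub hderiv (u := x - 1) (v := x) (by linarith) (by linarith)]
  have hlog := one_le_log_of_four_le hx
  have hM := log_le_add_mul_ell hx (Nat.one_le_iff_ne_zero.1 (hg n).1.1)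
  have hell : (ell (g n) : ℝ) ≤ n := by exact_mod_cast (hg n).1.2
  have h1 : Real.log x / x * (ell (g n) - primeSum x) + Chebyshev.theta x ≤
      Real.log x / x * liSqError li x + x := by
    have h2 : Real.log x / x * liSqError li x =
        Real.log x / x * (li (x ^ 2) - primeSum x) + (Chebyshev.theta x - x) := by
      rw [liSqError]
      field_simp
      ring
    have h3 : Real.log x / x * (ell (g n) - primeSum x) ≤
        Real.log x / x * (li (x ^ 2) - primeSum x) := by
      gcongr
      linarith
    linarith
  have h4 : Real.log x / x * liSqError li x ≤ -x ^ c := by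
    have hxc : 0 < x ^ c := Real.rpow_pos_of_pos (by linarith) _
    calc _ ≤ Real.log x / x * -x ^ (1 + c) := by gcongr
      _ = -(Real.log x * x ^ c) := by
        rw [Real.rpow_add (by linarith), Real.rpow_one]
        field_simp
      _ ≤ -x ^ c := by nlinarith
  linarith

lemma li_sq_le_of_liSqError_nonpos {li : ℝ → ℝ} {x : ℝ} (hx : 4 ≤ x)
    (herr : liSqError li x ≤ 0) : li (x ^ 2) ≤ 3 * x ^ 2 := by
  have hlog := one_le_log_of_four_le hx
  have h1 : x / Real.log x ≤ x := div_le_self (by linarith) hlog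
  have h2 : 0 ≤ x / Real.log x := by positivity
  have h3 := Chebyshev.theta_nonneg x
  have h4 := primeSum_le (x := x) (by linarith)
  rw [liSqError] at herr
  nlinarith [mul_nonneg h2 h3, mul_le_mul_of_nonneg_right h1 (show 0 ≤ x by linarith)]

/-- If the Riemann hypothesis fails, then `log g(n) - √(li⁻¹ n)` oscillates. -/
lemma exists_omega_of_not_riemannHypothesis {g : ℕ → ℕ}
    (hg : ∀ n, IsGreatest {M : ℕ | 1 ≤ M ∧ ell M ≤ n} (g n)) {li liInv : ℝ → ℝ}
    (hderiv : ∀ x : ℝ, 1 < x → HasDerivAt li (1 / Real.log x) x)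
    (hbij : Set.BijOn li (Set.Ioi 1) Set.univ)
    (hinv : ∀ x : ℝ, 1 < x → liInv (li x) = x) (h : ¬ RiemannHypothesis) :
    ∃ b : ℝ, 1 / 4 < b ∧ ∃ ε : ℝ, 0 < ε ∧
      (∃ᶠ n : ℕ in atTop,
        ε * ((n : ℝ) * Real.log n) ^ b < Real.log (g n) - √(liInv n)) ∧
      ∃ᶠ n : ℕ in atTop,
        Real.log (g n) - √(liInv n) < -(ε * ((n : ℝ) * Real.log n) ^ b) := by
  obtain ⟨c, hc, hfr⟩ := exists_frequently_rpow_le_liSqError hderiv h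
  obtain ⟨b, hb, ε, hε, hbound⟩ := exists_mul_log_rpow_le hc
  refine ⟨b, hb, ε, hε, ?_, ?_⟩
  · refine tendsto_primeSum_atTop.frequently (((hfr 1 (by norm_num)).and_eventually
      ((eventually_ge_atTop 4).and ((tendsto_theta_atTop.eventually_ge_atTop (Real.exp 1)).and
      ((tendsto_natCast_atTop_atTop.comp tendsto_primeSum_atTop).eventually_ge_atTop
        (li (Real.exp 1 ^ 2)))))).mono fun x ⟨herr, hx, hθ, hp⟩ ↦ ?_)
    have h1 := rpow_div_two_le_log_sub hg hderiv hbij hinv hx hθ hp (by linarith)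
    have h2 := hbound (primeSum x) x (by linarith)
      ((primeSum_le (by linarith)).trans (by nlinarith))
    have h3 : 0 < x ^ c := Real.rpow_pos_of_pos (by linarith) _
    linarith
  · have hsmall : ∀ᶠ x : ℝ in atTop, √x * Real.log x + 1 ≤ x ^ c / 2 := by
      have h1 : (fun _ : ℝ ↦ (1 : ℝ)) =o[atTop] fun x : ℝ ↦ x ^ c :=
        Asymptotics.isLittleO_const_left.2 (.inr <| tendsto_norm_atTop_atTop.comp <|
          tendsto_rpow_atTop (by linarith))
      filter_upwards [((sqrt_mul_log_isLittleO_rpow hc).add h1).bound one_half_pos,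
        eventually_gt_atTop 0] with x hx h0
      rw [Real.norm_eq_abs, Real.norm_eq_abs, abs_of_pos (Real.rpow_pos_of_pos h0 _)] at hx
      linarith [le_abs_self (√x * Real.log x + 1)]
    refine (tendsto_nat_floor_atTop.comp (tendsto_li_sq_atTop hderiv)).frequently
      (((hfr (-1) (by norm_num)).and_eventually ((eventually_ge_atTop 4).and
      (((tendsto_li_sq_atTop hderiv).eventually_ge_atTop 0).and hsmall))).mono
      fun x ⟨herr, hx, hli, hs⟩ ↦ ?_)
    have h3 : 0 < x ^ c := Real.rpow_pos_of_pos (by linarith) _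
    have h4 : 0 < x ^ (1 + c) := Real.rpow_pos_of_pos (by linarith) _
    have h1 := log_sub_le_neg_rpow hg hderiv hbij hinv hx hli (c := c) (by linarith)
    have h2 := hbound ⌊li (x ^ 2)⌋₊ x (by linarith)
      ((Nat.floor_le hli).trans (li_sq_le_of_liSqError_nonpos hx (by linarith)))
    simp only [Function.comp_apply]
    linarith

theorem stmt18 (g : ℕ → ℕ)
    (hg : ∀ n, IsGreatest {M : ℕ | 1 ≤ M ∧ ell M ≤ n} (g n))
    (li liInv : ℝ → ℝ)
    (hderiv : ∀ x : ℝ, 1 < x → HasDerivAt li (1 / Real.log x) x)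
    (hbij : Set.BijOn li (Set.Ioi 1) Set.univ)
    (hinv : ∀ x : ℝ, 1 < x → liInv (li x) = x) :
    (¬ RiemannHypothesis → ∃ b : ℝ, 1 / 4 < b ∧
      (∃ ε : ℝ, 0 < ε ∧ ∃ᶠ n : ℕ in Filter.atTop,
        ε * ((n : ℝ) * Real.log n) ^ b < Real.log (g n) - Real.sqrt (liInv n)) ∧
      (∃ ε : ℝ, 0 < ε ∧ ∃ᶠ n : ℕ in Filter.atTop,
        Real.log (g n) - Real.sqrt (liInv n) < -(ε * ((n : ℝ) * Real.log n) ^ b))) ∧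
    ((∀ n : ℕ, 1 ≤ n → Real.log (g n) < Real.sqrt (liInv n)) →
      RiemannHypothesis) := by
  refine ⟨fun h ↦ ?_, fun hlt ↦ ?_⟩
  · obtain ⟨b, hb, ε, hε, h1, h2⟩ := exists_omega_of_not_riemannHypothesis hg hderiv hbij hinv h
    exact ⟨b, hb, ⟨ε, hε, h1⟩, ε, hε, h2⟩
  · by_contra h
    obtain ⟨b, -, ε, hε, h1, -⟩ := exists_omega_of_not_riemannHypothesis hg hderiv hbij hinv h
    obtain ⟨n, hn, hn1⟩ := (h1.and_eventually (eventually_ge_atTop 1)).exists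
    have h2 : 0 ≤ ε * ((n : ℝ) * Real.log n) ^ b :=
      mul_nonneg hε.le (Real.rpow_nonneg
        (mul_nonneg n.cast_nonneg (Real.log_natCast_nonneg n)) _)
    linarith [hlt n hn1]
end
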